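/- Let 1 ≤ k ≤ n and 1 ≤ l ≤ m with n − k = m − l. If there exists an S³-equivariant continuous map f : ℍV_{n,k} → ℍV_{m,l} (equivariant with respect to the actions of the group of unit quaternions by entrywise left scalar multiplication), then the binomial coefficient C(n, n−k+1) divides the binomial coefficient C(m, m−l+1). -/

import Mathlib

open scoped Quaternion
open Matrix

/-- The quaternionic Stiefel manifold `ℍV_{n,k}` of orthonormal `k`-frames in `ℍⁿ`,
realized as the space of `k × n` quaternionic matrices `A` with `A * Aᴴ = 1`, with the
subspace topology from the space of matrices. -/
abbrev QStiefel (n k : ℕ) : Type :=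
  {A : Matrix (Fin k) (Fin n) ℍ[ℝ] // A * Aᴴ = 1}

namespace BrouwerDegree

open MeasureTheory Metric Set Filter Topology
open scoped ContDiff Pointwise Quaternion

section NullLagrangian

variable {E : Type*} [NormedAddCommGroup E] [NormedSpace ℝ E] [FiniteDimensional ℝ E]

theorem det_smul_id_add_pos {A : E →L[ℝ] E} {s : ℝ} (hs : ‖A‖ < s) :
    0 < (s • ContinuousLinearMap.id ℝ E + A).det := by
  have hs0 : 0 < s := (norm_nonneg A).trans_lt hs
  have hne : ∀ t ∈ Icc (0 : ℝ) 1, (s • ContinuousLinearMap.id ℝ E + t • A).det ≠ 0 := by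
    intro t ht h0
    have h1 : LinearMap.det ((s • ContinuousLinearMap.id ℝ E + t • A : E →L[ℝ] E) : E →ₗ[ℝ] E)
        = 0 := h0
    obtain ⟨x, hx, hx0⟩ := (LinearMap.bot_lt_ker_of_det_eq_zero h1).ne' |>
      (Submodule.ne_bot_iff _).1
    have h2 : s • x + t • A x = 0 := by simpa using hx
    have h3 : ‖s • x‖ = ‖t • A x‖ := by
      rw [eq_neg_of_add_eq_zero_left h2, norm_neg]
    rw [norm_smul, norm_smul, Real.norm_of_nonneg hs0.le, Real.norm_of_nonneg ht.1] at h3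
    have h4 : 0 < ‖x‖ := norm_pos_iff.2 hx0
    have h5 := A.le_opNorm x
    have h6 : t * ‖A x‖ ≤ 1 * ‖A x‖ := by gcongr; exact ht.2
    nlinarith
  by_contra hcon
  have hc : ContinuousOn (fun t : ℝ => (s • ContinuousLinearMap.id ℝ E + t • A).det)
      (Icc 0 1) :=
    (ContinuousLinearMap.continuous_det.comp (by fun_prop :
      Continuous fun t : ℝ => s • ContinuousLinearMap.id ℝ E + t • A)).continuousOn
  have hpos : 0 < (s • ContinuousLinearMap.id ℝ E + (0 : ℝ) • A).det := by
    simp only [zero_smul, add_zero]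
    rw [ContinuousLinearMap.det]
    simp only [ContinuousLinearMap.toLinearMap_smul, LinearMap.det_smul]
    simp only [ContinuousLinearMap.coe_id, LinearMap.det_id]
    positivity
  have := intermediate_value_Icc' (zero_le_one) hc
  obtain ⟨t, ht, h0⟩ := this (show (0 : ℝ) ∈ Icc _ _ from ⟨by simpa using hcon, hpos.le⟩)
  exact hne t ht h0

theorem sum_smul_pow_eq_zero_of_natDegree_lt (p : Polynomial ℝ) {n : ℕ} (hp : p.natDegree < n)
    (h : ℝ) :
    ∑ k ∈ Finset.range (n + 1), ((-1 : ℝ) ^ (n - k) * n.choose k) * p.eval (k * h) = 0 := by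
  have h1 := Polynomial.fwdDiff_iter_eq_zero_of_degree_lt
    (P := p.comp (Polynomial.C h * Polynomial.X)) (n := n) (by
    refine lt_of_le_of_lt Polynomial.natDegree_comp_le ?_
    refine lt_of_le_of_lt (Nat.mul_le_mul_left _ ((Polynomial.natDegree_C_mul_le h _).trans
      Polynomial.natDegree_X_le)) ?_
    simpa using hp)
  have h2 := congrFun h1 0
  rw [fwdDiff_iter_eq_sum_shift] at h2
  simp only [Pi.zero_apply, zsmul_eq_mul, Polynomial.eval_comp, Polynomial.eval_mul,
    Polynomial.eval_C, Polynomial.eval_X, zero_add, nsmul_eq_mul, mul_one] at h2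
  rw [← h2]
  refine Finset.sum_congr rfl fun k _ => ?_
  push_cast
  rw [mul_comm h]

variable [MeasurableSpace E] [BorelSpace E]

theorem integral_det_smul_id_add_fderiv (μ : Measure E) [μ.IsAddHaarMeasure] {h : E → E}
    (hh : ContDiff ℝ 1 h) {C : NNReal} (hC : ∀ x, ‖fderiv ℝ h x‖ ≤ C) {R : ℝ}
    (hR : ∀ x, x ∉ closedBall (0 : E) R → h x = 0) {s : ℝ} (hs : C < s) :
    ∫ x in closedBall (0 : E) R, (s • ContinuousLinearMap.id ℝ E + fderiv ℝ h x).det ∂μ =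
      s ^ Module.finrank ℝ E * μ.real (closedBall (0 : E) R) := by
  have hs0 : 0 < s := C.2.trans_lt hs
  have hlip : LipschitzWith C h := lipschitzWith_of_nnnorm_fderiv_le
    (hh.differentiable (by simp)) fun x => by exact_mod_cast hC x
  set T : E → E := fun x => s • x + h x with hT
  set e : E ≃L[ℝ] E := ContinuousLinearEquiv.smulLeft (Units.mk0 s hs0.ne') with he
  have hee : ∀ x, e x = s • x := fun x => rfl
  have happ : ApproximatesLinearOn T (e : E →L[ℝ] E) univ C := by
    intro x _ y _
    have : T x - T y - (e : E →L[ℝ] E) (x - y) = h x - h y := by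
      simp only [hT, ContinuousLinearEquiv.coe_coe, hee, smul_sub]; abel
    rw [this]
    exact hlip.norm_sub_le x y
  have hcase : Subsingleton E ∨ C < ‖(e.symm : E →L[ℝ] E)‖₊⁻¹ := by
    rcases subsingleton_or_nontrivial E with h | h
    · exact Or.inl h
    · right
      have h1 : ‖(e.symm : E →L[ℝ] E)‖ ≤ s⁻¹ := by
        refine ContinuousLinearMap.opNorm_le_bound _ (by positivity) fun x => ?_
        have : e.symm x = s⁻¹ • x := by
          rw [ContinuousLinearEquiv.symm_apply_eq, hee, smul_smul, mul_inv_cancel₀ hs0.ne',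
            one_smul]
        rw [ContinuousLinearEquiv.coe_coe, this, norm_smul, Real.norm_of_nonneg (by positivity)]
      have h2 : 0 < ‖(e.symm : E →L[ℝ] E)‖ := e.symm.norm_pos
      rw [← NNReal.coe_lt_coe, NNReal.coe_inv, coe_nnnorm]
      refine hs.trans_le ?_
      rw [le_inv_comm₀ hs0 h2]
      exact h1
  have hinj : Function.Injective T := injOn_univ.1 (happ.injOn hcase)
  have hsurj : Function.Surjective T := happ.surjective hcase
  have himg : T '' closedBall (0 : E) R = s • closedBall (0 : E) R := by
    ext y
    constructor
    · rintro ⟨x, hx, rfl⟩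
      by_contra hy
      have hu : s⁻¹ • T x ∉ closedBall (0 : E) R := fun hm =>
        hy ((mem_smul_set_iff_inv_smul_mem₀ hs0.ne' _ _).2 hm)
      have h1 : T (s⁻¹ • T x) = T x := by
        change s • (s⁻¹ • T x) + h (s⁻¹ • T x) = T x
        rw [hR _ hu, add_zero, smul_smul, mul_inv_cancel₀ hs0.ne', one_smul]
      rw [hinj h1] at hu
      exact hu hx
    · intro hy
      rw [mem_smul_set_iff_inv_smul_mem₀ hs0.ne'] at hy
      obtain ⟨x, rfl⟩ := hsurj y
      refine ⟨x, ?_, rfl⟩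
      by_contra hx
      rw [hT] at hy
      simp only [hR _ hx, add_zero] at hy
      rw [smul_smul, inv_mul_cancel₀ hs0.ne', one_smul] at hy
      exact hx hy
  have hder : ∀ x, HasFDerivAt T (s • ContinuousLinearMap.id ℝ E + fderiv ℝ h x) x := fun x =>
    ((hasFDerivAt_id x).const_smul s).add (hh.differentiable (by simp) x).hasFDerivAt
  have := integral_image_eq_integral_abs_det_fderiv_smul μ
    (isClosed_closedBall (x := (0 : E)) (ε := R)).measurableSet
    (fun x _ => (hder x).hasFDerivWithinAt) hinj.injOn (fun _ => (1 : ℝ))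
  rw [himg] at this
  simp only [integral_const, smul_eq_mul, mul_one, measureReal_restrict_apply_univ] at this
  rw [measureReal_def, Measure.addHaar_smul, ENNReal.toReal_mul, ← measureReal_def,
    ENNReal.toReal_ofReal (abs_nonneg _), abs_of_pos (by positivity)] at this
  rw [this]
  refine setIntegral_congr_fun isClosed_closedBall.measurableSet fun x _ => ?_
  rw [abs_of_pos (det_smul_id_add_pos ((hC x).trans_lt hs))]

/-- The Jacobian determinant of a compactly supported `C¹` self-map has integral zero. -/
theorem integral_det_fderiv_eq_zero [Nontrivial E] (μ : Measure E) [μ.IsAddHaarMeasure] {h : E → E}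
    (hh : ContDiff ℝ 1 h) (hc : HasCompactSupport h) :
    ∫ x, (fderiv ℝ h x).det ∂μ = 0 := by
  have hcf : Continuous (fderiv ℝ h) := hh.continuous_fderiv (by simp)
  obtain ⟨C, hC⟩ := (hc.fderiv (𝕜 := ℝ)).exists_bound_of_continuous hcf
  obtain ⟨R, hR⟩ := hc.isCompact.isBounded.subset_closedBall (0 : E)
  have hR' : ∀ x, x ∉ closedBall (0 : E) R → h x = 0 := fun x hx =>
    image_eq_zero_of_notMem_tsupport fun hx' => hx (hR hx')
  set B := closedBall (0 : E) R with hB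
  set N := Module.finrank ℝ E with hN
  have hNpos : 0 < N := Module.finrank_pos
  have hset : ∫ x, (fderiv ℝ h x).det ∂μ = ∫ x in B, (fderiv ℝ h x).det ∂μ := by
    refine (setIntegral_eq_integral_of_forall_compl_eq_zero fun x hx => ?_).symm
    have : fderiv ℝ h x = 0 := by
      refine image_eq_zero_of_notMem_tsupport fun hx' => hx (hR ?_)
      exact tsupport_fderiv_subset ℝ hx'
    rw [this]
    simp [ContinuousLinearMap.det]
  set q : ℝ → ℝ := fun s => ∫ x in B, (s • ContinuousLinearMap.id ℝ E + fderiv ℝ h x).det ∂μ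
    with hq
  have hq1 : ∀ s, max C 0 < s → q s = s ^ N * μ.real B := fun s hs =>
    integral_det_smul_id_add_fderiv μ hh (C := (max C 0).toNNReal)
      (fun x => by
        rw [Real.coe_toNNReal _ (le_max_right _ _)]
        exact (hC x).trans (le_max_left _ _))
      hR' (by rwa [Real.coe_toNNReal _ (le_max_right _ _)])
  set s₀ := max C 0 + 1 with hs₀
  have hdetcont : ∀ s : ℝ,
      Continuous fun x => (s • ContinuousLinearMap.id ℝ E + fderiv ℝ h x).det := fun s => by
    exact ContinuousLinearMap.continuous_det.comp (by fun_prop :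
      Continuous fun x => s • ContinuousLinearMap.id ℝ E + fderiv ℝ h x)
  have hint : ∀ s : ℝ, IntegrableOn
      (fun x => (s • ContinuousLinearMap.id ℝ E + fderiv ℝ h x).det) B μ := fun s =>
    (hdetcont s).continuousOn.integrableOn_compact (isCompact_closedBall _ _)
  have hsum : ∑ k ∈ Finset.range (N + 1 + 1),
      ((-1 : ℝ) ^ (N + 1 - k) * (N + 1).choose k) * q (k * s₀) = 0 := by
    simp only [hq]
    simp_rw [← integral_const_mul]
    rw [← integral_finsetSum _ fun k _ => (hint _).const_mul _]
    rw [← integral_zero E ℝ (μ := μ.restrict B)]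
    congr 1
    ext x
    have h1 : ∀ s : ℝ, (s • ContinuousLinearMap.id ℝ E + fderiv ℝ h x).det =
        (LinearMap.charpoly (-(fderiv ℝ h x : E →ₗ[ℝ] E))).eval s := by
      intro s
      rw [LinearMap.eval_charpoly, ContinuousLinearMap.det]
      congr 1
      ext y
      simp [Algebra.algebraMap_eq_smul_one]
    simp_rw [h1]
    exact sum_smul_pow_eq_zero_of_natDegree_lt _ (by rw [LinearMap.charpoly_natDegree]; omega) _
  have hsum' := sum_smul_pow_eq_zero_of_natDegree_lt (Polynomial.X ^ N * Polynomial.C (μ.real B))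
    (n := N + 1) (lt_of_le_of_lt Polynomial.natDegree_mul_le (by simp)) s₀
  rw [Finset.sum_range_succ'] at hsum hsum'
  have hs₀pos : 0 < s₀ := by positivity
  have heq : ∀ k : ℕ, q (((k + 1 : ℕ) : ℝ) * s₀) =
      (Polynomial.X ^ N * Polynomial.C (μ.real B)).eval (((k + 1 : ℕ) : ℝ) * s₀) := by
    intro k
    rw [hq1 _ _]
    · rw [Polynomial.eval_mul, Polynomial.eval_pow, Polynomial.eval_X, Polynomial.eval_C]
    · push_cast
      have : 0 ≤ (k : ℝ) * s₀ := by positivity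
      linarith
  simp_rw [heq] at hsum
  have h0 := hsum.trans hsum'.symm
  rw [add_right_inj] at h0
  have hq0 : q 0 = 0 := by
    have hc0 : ((-1 : ℝ) ^ (N + 1 - 0) * (N + 1).choose 0) ≠ 0 := by simp
    have h1 := mul_left_cancel₀ hc0 h0
    rw [Nat.cast_zero, zero_mul] at h1
    rw [h1, Polynomial.eval_mul, Polynomial.eval_pow, Polynomial.eval_X, zero_pow hNpos.ne',
      zero_mul]
  rw [hset]
  simpa [hq] using hq0

end NullLagrangian

section Homotopy

variable {E : Type*} [NormedAddCommGroup E] [NormedSpace ℝ E] [FiniteDimensional ℝ E]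

theorem det_of_snd_comp_inr_eq {L : ℝ × E →ₗ[ℝ] ℝ × E} (hL : ∀ y, (L (0, y)).1 = 0) :
    LinearMap.det L = (L (1, 0)).1 *
      LinearMap.det (LinearMap.snd ℝ ℝ E ∘ₗ L ∘ₗ LinearMap.inr ℝ ℝ E) := by
  classical
  let b := Module.Basis.singleton Unit ℝ
  let b' := Module.Free.chooseBasis ℝ E
  rw [← LinearMap.det_toMatrix (b.prod b'), ← LinearMap.det_toMatrix b']
  rw [← Matrix.fromBlocks_toBlocks (LinearMap.toMatrix (b.prod b') (b.prod b') L)]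
  have h12 : (LinearMap.toMatrix (b.prod b') (b.prod b') L).toBlocks₁₂ = 0 := by
    ext i j
    simp [Matrix.toBlocks₁₂, LinearMap.toMatrix_apply, hL, b]
  have h22 : (LinearMap.toMatrix (b.prod b') (b.prod b') L).toBlocks₂₂ =
      LinearMap.toMatrix b' b' (LinearMap.snd ℝ ℝ E ∘ₗ L ∘ₗ LinearMap.inr ℝ ℝ E) := by
    ext i j
    simp [Matrix.toBlocks₂₂, LinearMap.toMatrix_apply]
  have h11 : (LinearMap.toMatrix (b.prod b') (b.prod b') L).toBlocks₁₁.det = (L (1, 0)).1 := by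
    rw [Matrix.det_unique]
    simp [Matrix.toBlocks₁₁, LinearMap.toMatrix_apply, b]
  rw [h12, Matrix.det_fromBlocks_zero₁₂, h11, h22]

theorem det_of_snd_eq {L : ℝ × E →ₗ[ℝ] ℝ × E} (hL : ∀ p, (L p).2 = p.2) :
    LinearMap.det L = (L (1, 0)).1 := by
  classical
  let b := Module.Basis.singleton Unit ℝ
  let b' := Module.Free.chooseBasis ℝ E
  rw [← LinearMap.det_toMatrix (b.prod b')]
  rw [← Matrix.fromBlocks_toBlocks (LinearMap.toMatrix (b.prod b') (b.prod b') L)]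
  have h12 : (LinearMap.toMatrix (b.prod b') (b.prod b') L).toBlocks₂₁ = 0 := by
    ext i j
    simp [Matrix.toBlocks₂₁, LinearMap.toMatrix_apply, hL, b]
  have h22 : (LinearMap.toMatrix (b.prod b') (b.prod b') L).toBlocks₂₂ = 1 := by
    ext i j
    simp [Matrix.toBlocks₂₂, LinearMap.toMatrix_apply, hL, Matrix.one_apply,
      Finsupp.single_apply, eq_comm]
  have h11 : (LinearMap.toMatrix (b.prod b') (b.prod b') L).toBlocks₁₁.det = (L (1, 0)).1 := by
    rw [Matrix.det_unique]
    simp [Matrix.toBlocks₁₁, LinearMap.toMatrix_apply, b]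
  rw [h12, Matrix.det_fromBlocks_zero₂₁, h11, h22, Matrix.det_one, mul_one]

theorem det_prod_add_comp (c : ℝ) (ℓ : E →L[ℝ] ℝ) (B : ℝ × E →L[ℝ] E) :
    ((c • ContinuousLinearMap.fst ℝ ℝ E + ℓ ∘L B).prod B).det =
      c * (B ∘L ContinuousLinearMap.inr ℝ ℝ E).det := by
  have h1 : (((c • ContinuousLinearMap.fst ℝ ℝ E + ℓ ∘L B).prod B : ℝ × E →L[ℝ] ℝ × E) :
      ℝ × E →ₗ[ℝ] ℝ × E) =
      (((ContinuousLinearMap.fst ℝ ℝ E + ℓ ∘L ContinuousLinearMap.snd ℝ ℝ E).prod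
        (ContinuousLinearMap.snd ℝ ℝ E) : ℝ × E →L[ℝ] ℝ × E) : ℝ × E →ₗ[ℝ] ℝ × E) ∘ₗ
      (((c • ContinuousLinearMap.fst ℝ ℝ E).prod B : ℝ × E →L[ℝ] ℝ × E) :
        ℝ × E →ₗ[ℝ] ℝ × E) := by
    refine LinearMap.ext fun p => ?_
    simp
  rw [ContinuousLinearMap.det, h1, LinearMap.det_comp, det_of_snd_eq (by simp),
    det_of_snd_comp_inr_eq (by simp)]
  simp only [ContinuousLinearMap.coe_coe, ContinuousLinearMap.prod_apply]
  simp
  left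
  rfl

theorem deriv_smoothTransition_sub_eq_zero {a t : ℝ} (ht : t < a ∨ a + 1 < t) :
    deriv (fun t => Real.smoothTransition (t - a)) t = 0 := by
  rcases ht with h | h
  · have : (fun t : ℝ => Real.smoothTransition (t - a)) =ᶠ[𝓝 t] fun _ => 0 := by
      filter_upwards [Iio_mem_nhds h] with s hs
      exact Real.smoothTransition.zero_of_nonpos (by linarith [mem_Iio.1 hs])
    rw [this.deriv_eq, deriv_const]
  · have : (fun t : ℝ => Real.smoothTransition (t - a)) =ᶠ[𝓝 t] fun _ => 1 := by
      filter_upwards [Ioi_mem_nhds h] with s hs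
      exact Real.smoothTransition.one_of_one_le (by linarith [mem_Ioi.1 hs])
    rw [this.deriv_eq, deriv_const]

theorem contDiff_smoothTransition_sub (a : ℝ) :
    ContDiff ℝ 1 (fun t : ℝ => Real.smoothTransition (t - a)) :=
  Real.smoothTransition.contDiff.comp (by fun_prop)

theorem integral_deriv_smoothTransition_sub (a : ℝ) :
    ∫ t : ℝ, deriv (fun t => Real.smoothTransition (t - a)) t = 1 := by
  have hd := contDiff_smoothTransition_sub a
  rw [← intervalIntegral.integral_eq_integral_of_support_subset (a := a - 1) (b := a + 2)]
  · rw [intervalIntegral.integral_deriv_eq_sub' _ rfl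
      (fun x _ => (hd.differentiable (by simp)).differentiableAt)
      (hd.continuous_deriv le_rfl).continuousOn]
    rw [Real.smoothTransition.one_of_one_le (by linarith),
      Real.smoothTransition.zero_of_nonpos (by linarith)]
    norm_num
  · intro t ht
    by_contra hcon
    refine ht (deriv_smoothTransition_sub_eq_zero ?_)
    rw [mem_Ioc, not_and_or, not_lt, not_le] at hcon
    rcases hcon with h | h
    · left; linarith
    · right; linarith

theorem integrable_deriv_smoothTransition_sub (a : ℝ) :
    Integrable (deriv fun t => Real.smoothTransition (t - a)) := by
  refine ((contDiff_smoothTransition_sub a).continuous_deriv le_rfl).integrable_of_hasCompactSupport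
    (HasCompactSupport.intro (K := Icc a (a + 1)) isCompact_Icc fun t ht => ?_)
  refine deriv_smoothTransition_sub_eq_zero ?_
  rwa [mem_Icc, not_and_or, not_le, not_le] at ht

variable [MeasurableSpace E] [BorelSpace E] (μ : Measure E) [μ.IsAddHaarMeasure]

/-- The integral of the pulled-back density does not change along a homotopy which
keeps the complement of a compact set away from the support of the density. -/
theorem integral_comp_mul_det_homotopy {η : E → ℝ} (hη : ContDiff ℝ 1 η) {G : ℝ × E → E}
    (hG : ContDiff ℝ 1 G) {W K : Set E} (hW : IsOpen W) (hK : IsCompact K) (hKW : K ⊆ W)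
    (h0 : ∀ t ∈ Icc (0 : ℝ) 1, ∀ x ∈ W \ K, η (G (t, x)) = 0) :
    ∫ x in W, η (G (0, x)) * (fderiv ℝ (fun y => G (0, y)) x).det ∂μ =
      ∫ x in W, η (G (1, x)) * (fderiv ℝ (fun y => G (1, y)) x).det ∂μ := by
  classical
  set J : ℝ → ℝ := fun t => ∫ x in W, η (G (t, x)) * (fderiv ℝ (fun y => G (t, y)) x).det ∂μ
    with hJ
  change J 0 = J 1
  set θ : ℝ → ℝ := fun t => Real.smoothTransition t with hθ
  have hθI : ∀ t, θ t ∈ Icc (0 : ℝ) 1 := fun t =>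
    ⟨Real.smoothTransition.nonneg t, Real.smoothTransition.le_one t⟩
  set G' : ℝ × E → E := fun p => G (θ p.1, p.2) with hG'
  have hθc : ContDiff ℝ 1 θ := Real.smoothTransition.contDiff
  have hG'c : ContDiff ℝ 1 G' := hG.comp ((hθc.comp contDiff_fst).prodMk contDiff_snd)
  set σ : ℝ → ℝ → ℝ := fun a t => Real.smoothTransition (t - a) with hσ
  set β : ℝ → ℝ := fun t => σ (-1) t - σ 1 t with hβ
  have hβc : ContDiff ℝ 1 β :=
    (contDiff_smoothTransition_sub (-1)).sub (contDiff_smoothTransition_sub 1)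
  have hβd : ∀ t, deriv β t = deriv (σ (-1)) t - deriv (σ 1) t := fun t =>
    deriv_sub ((contDiff_smoothTransition_sub (-1)).differentiable (by simp)).differentiableAt
      ((contDiff_smoothTransition_sub 1).differentiable (by simp)).differentiableAt
  have hβ0 : ∀ t, t < -1 ∨ 2 < t → β t = 0 := by
    rintro t (h | h)
    · simp only [hβ, hσ]
      rw [Real.smoothTransition.zero_of_nonpos (by linarith),
        Real.smoothTransition.zero_of_nonpos (by linarith), sub_zero]
    · simp only [hβ, hσ]
      rw [Real.smoothTransition.one_of_one_le (by linarith),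
        Real.smoothTransition.one_of_one_le (by linarith), sub_self]
  set ψ : ℝ × E → ℝ := fun p => if p.2 ∈ W then β p.1 * η (G' p) else 0 with hψ
  have hψ0 : ∀ p : ℝ × E, (p.1 < -1 ∨ 2 < p.1 ∨ p.2 ∉ K) → ψ p = 0 := by
    rintro ⟨t, x⟩ h
    simp only [hψ]
    split_ifs with hx
    · rcases or_assoc.2 h with h | h
      · rw [hβ0 _ h, zero_mul]
      · rw [hG', h0 _ (hθI t) x ⟨hx, h⟩, mul_zero]
    · rfl
  have hψ0' : ∀ p : ℝ × E, (p.1 < -1 ∨ 2 < p.1 ∨ p.2 ∉ K) → ψ =ᶠ[𝓝 p] fun _ => 0 := by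
    intro p hp
    have ho : IsOpen {p : ℝ × E | p.1 < -1 ∨ 2 < p.1 ∨ p.2 ∉ K} :=
      (isOpen_lt continuous_fst continuous_const).union
        ((isOpen_lt continuous_const continuous_fst).union
          (hK.isClosed.isOpen_compl.preimage continuous_snd))
    filter_upwards [ho.mem_nhds hp] with q hq using hψ0 q hq
  have hψW : ∀ p : ℝ × E, p.2 ∈ W → ψ =ᶠ[𝓝 p] fun p => β p.1 * η (G' p) := by
    intro p hp
    filter_upwards [(hW.preimage continuous_snd).mem_nhds hp] with q hq
    exact if_pos hq
  have hψc : ContDiff ℝ 1 ψ := by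
    rw [contDiff_iff_contDiffAt]
    intro p
    by_cases hp : p.2 ∈ K
    · refine ContDiffAt.congr_of_eventuallyEq ?_ (hψW p (hKW hp))
      exact ((hβc.comp contDiff_fst).mul (hη.comp hG'c)).contDiffAt
    · exact contDiffAt_const.congr_of_eventuallyEq (hψ0' p (Or.inr (Or.inr hp)))
  obtain ⟨R, hR0, hR⟩ : ∃ R > 0, Icc (-1 : ℝ) 2 ×ˢ K ⊆ ball 0 R :=
    (isCompact_Icc.prod hK).isBounded.subset_ball_lt 0 0
  let χ : ContDiffBump (0 : ℝ × E) := ⟨R, R + 1, hR0, by linarith⟩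
  set h : ℝ × E → ℝ × E := fun p => (ψ p, χ p • G' p) with hh
  have hhc : ContDiff ℝ 1 h := hψc.prodMk (χ.contDiff.smul hG'c)
  have hIcc : ∀ p : ℝ × E, ¬ (p.1 < -1 ∨ 2 < p.1 ∨ p.2 ∉ K) → p ∈ Icc (-1 : ℝ) 2 ×ˢ K := by
    intro p hp
    push Not at hp
    exact ⟨⟨hp.1, hp.2.1⟩, hp.2.2⟩
  have hhs : HasCompactSupport h := by
    refine HasCompactSupport.intro (isCompact_closedBall (0 : ℝ × E) (R + 1)) fun p hp => ?_
    have h1 : χ p = 0 := by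
      by_contra hne
      have h2 : p ∈ Function.support χ := hne
      rw [χ.support_eq] at h2
      exact hp (ball_subset_closedBall h2)
    have h2 : ψ p = 0 := by
      refine hψ0 p ?_
      by_contra hcon
      exact hp (ball_subset_closedBall (ball_subset_ball (by simp) (hR (hIcc p hcon))))
    simp only [hh, h1, h2, zero_smul]
    rfl
  have hdet : ∀ p : ℝ × E, (fderiv ℝ h p).det =
      deriv β p.1 * (W.indicator (fun x => η (G (θ p.1, x)) *
        (fderiv ℝ (fun y => G (θ p.1, y)) x).det) p.2) := by
    intro p
    by_cases hp : p.1 < -1 ∨ 2 < p.1 ∨ p.2 ∉ K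
    · have h1 : fderiv ℝ ψ p = 0 := by
        rw [(hψ0' p hp).fderiv_eq]; simp
      have h2 : fderiv ℝ h p = (fderiv ℝ ψ p).prod (fderiv ℝ (fun p => χ p • G' p) p) :=
        DifferentiableAt.fderiv_prodMk (hψc.differentiable (by simp) p)
          ((χ.contDiff.smul hG'c).differentiable (by simp) p)
      have h3 : (fderiv ℝ h p).det = 0 := by
        rw [h2, h1]
        have := det_prod_add_comp 0 (0 : E →L[ℝ] ℝ) (fderiv ℝ (fun p => χ p • G' p) p)
        simpa using this
      rw [h3]
      rcases or_assoc.2 hp with h4 | h4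
      · have : deriv β p.1 = 0 := by
          rw [hβd]
          simp only [hσ]
          rw [deriv_smoothTransition_sub_eq_zero, deriv_smoothTransition_sub_eq_zero, sub_zero]
          · rcases h4 with h4 | h4
            · left; linarith
            · right; linarith
          · rcases h4 with h4 | h4
            · left; linarith
            · right; linarith
        rw [this, zero_mul]
      · rw [eq_comm, mul_eq_zero]
        right
        rw [indicator_apply]
        split_ifs with hx
        · rw [h0 _ (hθI _) _ ⟨hx, h4⟩, zero_mul]
        · rfl
    · have hpI := hIcc p hp
      have hpW : p.2 ∈ W := hKW hpI.2
      have hloc : h =ᶠ[𝓝 p] fun p => (β p.1 * η (G' p), G' p) := by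
        have h1 : χ =ᶠ[𝓝 p] 1 := χ.eventuallyEq_one_of_mem_ball (hR hpI)
        filter_upwards [h1, hψW p hpW] with q hq1 hq2
        simp only [hh, hq1, hq2, Pi.one_apply, one_smul]
      have hGd : HasFDerivAt G' (fderiv ℝ G' p) p :=
        (hG'c.differentiable (by simp) p).hasFDerivAt
      have hβh : HasFDerivAt (fun p : ℝ × E => β p.1)
          (deriv β p.1 • ContinuousLinearMap.fst ℝ ℝ E) p := by
        have h1 : HasDerivAt β (deriv β p.1) p.1 :=
          (hβc.differentiable (by simp) p.1).hasDerivAt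
        exact h1.comp_hasFDerivAt p hasFDerivAt_fst
      have hηh : HasFDerivAt (fun p => η (G' p)) (fderiv ℝ η (G' p) ∘L fderiv ℝ G' p) p :=
        ((hη.differentiable (by simp) (G' p)).hasFDerivAt).comp p hGd
      have h2 := (hβh.mul hηh).prodMk hGd
      rw [hloc.fderiv_eq]
      refine (congrArg ContinuousLinearMap.det h2.fderiv).trans ?_
      have h3 : (β p.1 • fderiv ℝ η (G' p) ∘L fderiv ℝ G' p +
          η (G' p) • deriv β p.1 • ContinuousLinearMap.fst ℝ ℝ E) =
          (η (G' p) * deriv β p.1) • ContinuousLinearMap.fst ℝ ℝ E +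
            (β p.1 • fderiv ℝ η (G' p)) ∘L fderiv ℝ G' p := by
        rw [smul_smul, add_comm, ContinuousLinearMap.smul_comp]
      rw [h3, det_prod_add_comp, indicator_of_mem hpW]
      have h4 : HasFDerivAt (fun y => G (θ p.1, y))
          (fderiv ℝ G' p ∘L ContinuousLinearMap.inr ℝ ℝ E) p.2 :=
        HasFDerivAt.comp (f := fun y : E => (p.1, y)) p.2 (g := G') hGd
          (hasFDerivAt_prodMk_right p.1 p.2)
      rw [h4.fderiv]
      simp only [hG']
      ring
  have hmain := integral_det_fderiv_eq_zero ((volume : Measure ℝ).prod μ) hhc hhs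
  have hint : Integrable (fun p => (fderiv ℝ h p).det) ((volume : Measure ℝ).prod μ) := by
    refine Continuous.integrable_of_hasCompactSupport
      (ContinuousLinearMap.continuous_det.comp (hhc.continuous_fderiv (by simp))) ?_
    refine (hhs.fderiv (𝕜 := ℝ)).comp_left (g := ContinuousLinearMap.det) ?_
    have := det_prod_add_comp 0 (0 : E →L[ℝ] ℝ) 0
    rw [zero_mul] at this
    rw [← this]
    congr 1
    ext p <;> simp
  rw [integral_prod _ hint] at hmain
  have hinner : ∀ t, ∫ x, (fderiv ℝ h (t, x)).det ∂μ =
      deriv (σ (-1)) t * J 0 - deriv (σ 1) t * J 1 := by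
    intro t
    simp_rw [hdet]
    rw [integral_const_mul, integral_indicator hW.measurableSet, hβd]
    change (_ - _) * J (θ t) = _
    rw [sub_mul]
    have h1 : deriv (σ (-1)) t * J (θ t) = deriv (σ (-1)) t * J 0 := by
      rcases le_or_gt t 0 with ht | ht
      · rw [show θ t = 0 from Real.smoothTransition.zero_of_nonpos ht]
      · simp only [hσ]
        rw [deriv_smoothTransition_sub_eq_zero (Or.inr (by linarith)), zero_mul, zero_mul]
    have h2 : deriv (σ 1) t * J (θ t) = deriv (σ 1) t * J 1 := by
      rcases le_or_gt 1 t with ht | ht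
      · rw [show θ t = 1 from Real.smoothTransition.one_of_one_le ht]
      · simp only [hσ]
        rw [deriv_smoothTransition_sub_eq_zero (Or.inl ht), zero_mul, zero_mul]
    rw [h1, h2]
  simp_rw [hinner] at hmain
  rw [integral_sub ((integrable_deriv_smoothTransition_sub _).mul_const _)
    ((integrable_deriv_smoothTransition_sub _).mul_const _), integral_mul_const,
    integral_mul_const, integral_deriv_smoothTransition_sub, integral_deriv_smoothTransition_sub]
    at hmain
  linarith

end Homotopy

section Degree

variable {E : Type*} [NormedAddCommGroup E] [NormedSpace ℝ E] [FiniteDimensional ℝ E]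
  [MeasurableSpace E] (μ : Measure E)

/-- A smooth probability density supported in the unit ball. -/
noncomputable def unitDensity : E → ℝ :=
  (⟨1 / 2, 1, by norm_num, by norm_num⟩ : ContDiffBump (0 : E)).normed μ

/-- The integral over `W` of the pull-back of the unit density by `g`. -/
noncomputable def pullInt (g : E → E) (W : Set E) : ℝ :=
  ∫ x in W, unitDensity μ (g x) * (fderiv ℝ g x).det ∂μ

/-- `g` has degree `d` on `W` over the origin. -/
def HasDeg (g : E → E) (W : Set E) (d : ℤ) : Prop :=
  ∃ s₀ : ℝ, ∀ s ≥ s₀, pullInt μ (fun x => s • g x) W = d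

variable {μ}

theorem HasDeg.unique {g : E → E} {W : Set E} {d d' : ℤ} (h : HasDeg μ g W d)
    (h' : HasDeg μ g W d') : d = d' := by
  obtain ⟨s, hs⟩ := h
  obtain ⟨s', hs'⟩ := h'
  have h1 := hs (max s s') (le_max_left _ _)
  rw [hs' _ (le_max_right _ _)] at h1
  exact_mod_cast h1.symm

theorem contDiff_unitDensity : ContDiff ℝ 1 (unitDensity μ) :=
  ContDiffBump.contDiff_normed (n := 1) _

variable [BorelSpace E] [μ.IsAddHaarMeasure]

theorem integral_unitDensity : ∫ x, unitDensity μ x ∂μ = 1 :=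
  ContDiffBump.integral_normed _

theorem unitDensity_eq_zero {x : E} (hx : 1 ≤ ‖x‖) : unitDensity μ x = 0 := by
  by_contra h
  have h1 : x ∈ Function.support (unitDensity μ) := h
  rw [unitDensity, ContDiffBump.support_normed_eq] at h1
  rw [mem_ball_zero_iff] at h1
  exact h1.not_ge hx

theorem hasDeg_homotopy {G : ℝ × E → E} (hG : ContDiff ℝ 1 G) {W K : Set E} (hW : IsOpen W)
    (hK : IsCompact K) (hKW : K ⊆ W) {r : ℝ} (hr : 0 < r)
    (h0 : ∀ t ∈ Icc (0 : ℝ) 1, ∀ x ∈ W \ K, r ≤ ‖G (t, x)‖) {d : ℤ} :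
    HasDeg μ (fun x => G (0, x)) W d ↔ HasDeg μ (fun x => G (1, x)) W d := by
  have key : ∀ s ≥ r⁻¹, pullInt μ (fun x => s • G (0, x)) W =
      pullInt μ (fun x => s • G (1, x)) W := by
    intro s hs
    have hs0 : 0 < s := (inv_pos.2 hr).trans_le hs
    refine integral_comp_mul_det_homotopy μ contDiff_unitDensity
      (G := fun p => s • G p) (contDiff_const.smul hG) hW hK hKW fun t ht x hx => ?_
    refine unitDensity_eq_zero ?_
    rw [norm_smul, Real.norm_of_nonneg hs0.le]
    calc 1 = r⁻¹ * r := (inv_mul_cancel₀ hr.ne').symm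
      _ ≤ s * ‖G (t, x)‖ := by
        gcongr
        exact h0 t ht x hx
  constructor
  · rintro ⟨s₀, hs₀⟩
    exact ⟨max s₀ r⁻¹, fun s hs => by
      rw [← key s ((le_max_right _ _).trans hs), hs₀ s ((le_max_left _ _).trans hs)]⟩
  · rintro ⟨s₀, hs₀⟩
    exact ⟨max s₀ r⁻¹, fun s hs => by
      rw [key s ((le_max_right _ _).trans hs), hs₀ s ((le_max_left _ _).trans hs)]⟩

theorem hasDeg_sum {g : E → E} (hg : ContDiff ℝ 1 g) {W K : Set E} (hW : IsOpen W)
    (hK : IsCompact K) {r : ℝ} (hr : 0 < r)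
    (h0 : ∀ x ∈ W \ K, r ≤ ‖g x‖) {ι : Type*} (s : Finset ι) {V : ι → Set E}
    (hV : ∀ i ∈ s, IsOpen (V i)) (hVW : ∀ i ∈ s, V i ⊆ W)
    (hdisj : (s : Set ι).PairwiseDisjoint V)
    (h1 : ∀ x ∈ W \ ⋃ i ∈ s, V i, r ≤ ‖g x‖) {d : ι → ℤ}
    (hd : ∀ i ∈ s, HasDeg μ g (V i) (d i)) :
    HasDeg μ g W (∑ i ∈ s, d i) := by
  choose! S hS using hd
  refine ⟨max r⁻¹ (∑ i ∈ s, |S i|), fun a ha => ?_⟩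
  have ha0 : r⁻¹ ≤ a := (le_max_left _ _).trans ha
  have haS : ∀ i ∈ s, S i ≤ a := fun i hi =>
    ((le_abs_self _).trans (Finset.single_le_sum (f := fun i => |S i|)
      (fun j _ => abs_nonneg _) hi)).trans ((le_max_right _ _).trans ha)
  have hapos : 0 < a := (inv_pos.2 hr).trans_le ha0
  have hzero : ∀ x, r ≤ ‖g x‖ → unitDensity μ (a • g x) = 0 := by
    intro x hx
    refine unitDensity_eq_zero ?_
    rw [norm_smul, Real.norm_of_nonneg hapos.le]
    calc 1 = r⁻¹ * r := (inv_mul_cancel₀ hr.ne').symm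
      _ ≤ a * ‖g x‖ := by gcongr
  set F : E → ℝ := fun x => unitDensity μ (a • g x) * (fderiv ℝ (fun x => a • g x) x).det
    with hF
  have hFc : Continuous F := by
    refine Continuous.mul (contDiff_unitDensity.continuous.comp (hg.continuous.const_smul a)) ?_
    exact ContinuousLinearMap.continuous_det.comp
      ((contDiff_const.smul hg).continuous_fderiv (by simp))
  have hint : IntegrableOn F W μ := by
    have h2 : IntegrableOn F (W ∩ K) μ :=
      (hFc.continuousOn.integrableOn_compact hK).mono_set inter_subset_right
    refine h2.of_forall_sdiff_eq_zero hW.measurableSet fun x hx => ?_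
    rw [hF]
    simp only
    rw [hzero x (h0 x ⟨hx.1, fun hk => hx.2 ⟨hx.1, hk⟩⟩), zero_mul]
  have h2 : pullInt μ (fun x => a • g x) W = ∫ x in ⋃ i ∈ s, V i, F x ∂μ := by
    refine (setIntegral_eq_of_subset_of_forall_sdiff_eq_zero hW.measurableSet
      (iUnion₂_subset hVW) fun x hx => ?_)
    rw [hzero x (h1 x hx), zero_mul]
  rw [h2, integral_biUnion_finset s (fun i hi => (hV i hi).measurableSet) hdisj
    (fun i hi => hint.mono_set (hVW i hi))]
  push_cast
  exact Finset.sum_congr rfl fun i hi => hS i hi a (haS i hi)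

theorem hasDeg_of_injOn {g : E → E} (hg : ContDiff ℝ 1 g) {W : Set E} (hW : IsOpen W)
    (hinj : InjOn g W) (h0 : g '' W ∈ 𝓝 0) (u : ℤˣ)
    (hu : ∀ x ∈ W, 0 < ((u : ℤ) : ℝ) * (fderiv ℝ g x).det) : HasDeg μ g W u := by
  obtain ⟨ε, hε, hball⟩ := Metric.mem_nhds_iff.1 h0
  refine ⟨ε⁻¹, fun s hs => ?_⟩
  have hs0 : 0 < s := (inv_pos.2 hε).trans_le hs
  have hgs : ContDiff ℝ 1 fun x => s • g x := contDiff_const.smul hg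
  have hinj' : InjOn (fun x => s • g x) W := fun x hx y hy hxy =>
    hinj hx hy (smul_right_injective E hs0.ne' hxy)
  have hd : ∀ x, HasFDerivAt (fun x => s • g x) (fderiv ℝ (fun x => s • g x) x) x := fun x =>
    (hgs.differentiable (by simp) x).hasFDerivAt
  have hcov := integral_image_eq_integral_abs_det_fderiv_smul μ hW.measurableSet
    (fun x _ => (hd x).hasFDerivWithinAt) hinj' (unitDensity μ)
  have himage : ∫ y in (fun x => s • g x) '' W, unitDensity μ y ∂μ = 1 := by
    rw [setIntegral_eq_integral_of_forall_compl_eq_zero, integral_unitDensity]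
    intro y hy
    refine unitDensity_eq_zero ?_
    by_contra hlt
    push Not at hlt
    have h1 : s⁻¹ • y ∈ ball (0 : E) ε := by
      rw [mem_ball_zero_iff, norm_smul, norm_inv, Real.norm_of_nonneg hs0.le]
      calc s⁻¹ * ‖y‖ < s⁻¹ * 1 := by gcongr
        _ ≤ ε := by rw [mul_one]; exact inv_le_of_inv_le₀ hε hs
    obtain ⟨x, hx, hxy⟩ := hball h1
    refine hy ⟨x, hx, ?_⟩
    exact (congrArg (s • ·) hxy).trans (smul_inv_smul₀ hs0.ne' y)
  rw [himage] at hcov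
  have husq : ((u : ℤ) : ℝ) * ((u : ℤ) : ℝ) = 1 := by
    rcases Int.units_eq_one_or u with rfl | rfl <;> simp
  have habsu : |((u : ℤ) : ℝ)| = 1 := by
    rcases Int.units_eq_one_or u with rfl | rfl <;> simp
  rw [← mul_one ((u : ℤ) : ℝ), hcov, ← integral_const_mul]
  refine setIntegral_congr_fun hW.measurableSet fun x hx => ?_
  have h1 : (fderiv ℝ (fun x => s • g x) x).det =
      s ^ Module.finrank ℝ E * (fderiv ℝ g x).det := by
    rw [fderiv_fun_const_smul (hg.differentiable (by simp) x), ContinuousLinearMap.det,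
      ContinuousLinearMap.toLinearMap_smul, LinearMap.det_smul]
  have h2 : |(fderiv ℝ (fun x => s • g x) x).det| =
      ((u : ℤ) : ℝ) * (fderiv ℝ (fun x => s • g x) x).det := by
    rw [← one_mul |_|, ← habsu, ← abs_mul, abs_of_pos]
    rw [h1, mul_left_comm]
    have := hu x hx
    positivity
  simp only
  rw [h2, smul_eq_mul]
  linear_combination (-(fderiv ℝ (fun x => s • g x) x).det * unitDensity μ (s • g x)) * husq

theorem hasDeg_id {W : Set E} (hW : IsOpen W) (h0 : (0 : E) ∈ W) :
    HasDeg μ (fun x => x) W 1 := by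
  refine hasDeg_of_injOn contDiff_id hW (injOn_id W) ?_ 1 fun x _ => ?_
  · simpa using hW.mem_nhds h0
  · simp [ContinuousLinearMap.det]

theorem exists_hasDeg_of_regular {g : E → E} (hg : ContDiff ℝ 1 g) {W K : Set E} (hW : IsOpen W)
    (hK : IsCompact K) (hKW : K ⊆ W) {r : ℝ} (hr : 0 < r) (h0 : ∀ x ∈ W \ K, r ≤ ‖g x‖)
    (hreg : ∀ x, g x = 0 → (fderiv ℝ g x).det ≠ 0) : ∃ d, HasDeg μ g W d := by
  classical
  have hloc : ∀ x, g x = 0 → ∃ U, IsOpen U ∧ x ∈ U ∧ InjOn g U ∧ ∃ u : ℤˣ,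
      ∀ y ∈ U, 0 < ((u : ℤ) : ℝ) * (fderiv ℝ g y).det := by
    intro x hx
    have hstrict : HasStrictFDerivAt g
        ((fderiv ℝ g x).toContinuousLinearEquivOfDetNeZero (hreg x hx) : E →L[ℝ] E) x := by
      rw [ContinuousLinearMap.coe_toContinuousLinearEquivOfDetNeZero]
      exact hg.contDiffAt.hasStrictFDerivAt (by simp)
    have hdetc : Continuous fun y => (fderiv ℝ g y).det :=
      ContinuousLinearMap.continuous_det.comp (hg.continuous_fderiv (by simp))
    obtain ⟨u, hu⟩ : ∃ u : ℤˣ, 0 < ((u : ℤ) : ℝ) * (fderiv ℝ g x).det := by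
      rcases lt_or_gt_of_ne (hreg x hx) with h | h
      · exact ⟨-1, by simpa using h⟩
      · exact ⟨1, by simpa using h⟩
    refine ⟨(hstrict.toOpenPartialHomeomorph g).source ∩
      {y | 0 < ((u : ℤ) : ℝ) * (fderiv ℝ g y).det},
      (hstrict.toOpenPartialHomeomorph g).open_source.inter
        (isOpen_lt continuous_const (continuous_const.mul hdetc)),
      ⟨hstrict.mem_toOpenPartialHomeomorph_source, hu⟩, ?_, u, fun y hy => hy.2⟩
    have := (hstrict.toOpenPartialHomeomorph g).injOn
    rw [hstrict.toOpenPartialHomeomorph_coe] at this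
    exact this.mono inter_subset_left
  choose! U hUo hxU hUinj u hu using hloc
  set Z : Set E := K ∩ g ⁻¹' {0} with hZ
  have hZc : IsCompact Z := hK.inter_right (isClosed_singleton.preimage hg.continuous)
  have hZfin : Z.Finite := by
    obtain ⟨t, ht, htZ⟩ := hZc.elim_nhds_subcover U fun x hx =>
      (hUo x hx.2).mem_nhds (hxU x hx.2)
    refine t.finite_toSet.subset fun z hz => ?_
    obtain ⟨x, hxt, hzx⟩ := mem_iUnion₂.1 (htZ hz)
    have hx := ht x hxt
    rwa [hUinj x hx.2 hzx (hxU x hx.2) (hz.2.trans hx.2.symm)]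
  obtain ⟨O, hO, hOd⟩ := hZfin.t2_separation
  set V : E → Set E := fun x => W ∩ U x ∩ O x with hV
  have hVo : ∀ x ∈ Z, IsOpen (V x) := fun x hx => (hW.inter (hUo x hx.2)).inter (hO x).2
  have hxV : ∀ x ∈ Z, x ∈ V x := fun x hx => ⟨⟨hKW hx.1, hxU x hx.2⟩, (hO x).1⟩
  have hmem : ∀ x, x ∈ hZfin.toFinset ↔ x ∈ Z := fun x => hZfin.mem_toFinset
  obtain ⟨r', hr', hr'K⟩ : ∃ r' > 0, ∀ x ∈ K \ ⋃ i ∈ hZfin.toFinset, V i, r' ≤ ‖g x‖ := by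
    have hc : IsCompact (K \ ⋃ i ∈ hZfin.toFinset, V i) :=
      hK.diff (isOpen_biUnion fun i hi => hVo i ((hmem i).1 hi))
    rcases (K \ ⋃ i ∈ hZfin.toFinset, V i).eq_empty_or_nonempty with he | hne
    · exact ⟨1, one_pos, fun x hx => absurd (he ▸ hx : x ∈ (∅ : Set E)) (notMem_empty x)⟩
    · obtain ⟨x, hx, hmin⟩ := hc.exists_isMinOn hne hg.continuous.norm.continuousOn
      refine ⟨‖g x‖, norm_pos_iff.2 fun h => hx.2 ?_, fun y hy => hmin hy⟩
      have hxZ : x ∈ Z := ⟨hx.1, h⟩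
      exact mem_iUnion₂.2 ⟨x, (hmem x).2 hxZ, hxV x hxZ⟩
  refine ⟨_, hasDeg_sum hg hW hK (r := min r r') (lt_min hr hr')
    (fun x hx => (min_le_left _ _).trans (h0 x hx)) hZfin.toFinset (V := V)
    (fun x hx => hVo x ((hmem x).1 hx)) (fun x _ => inter_subset_left.trans inter_subset_left)
    (fun x hx y hy hxy => ?_) (fun x hx => ?_) (d := fun x => (u x : ℤ)) fun x hx => ?_⟩
  · exact (hOd ((hmem x).1 hx) ((hmem y).1 hy) hxy).mono inter_subset_right inter_subset_right
  · by_cases hxK : x ∈ K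
    · exact (min_le_right _ _).trans (hr'K x ⟨hxK, hx.2⟩)
    · exact (min_le_left _ _).trans (h0 x ⟨hx.1, hxK⟩)
  · rw [hmem] at hx
    refine hasDeg_of_injOn hg (hVo x hx) ((hUinj x hx.2).mono
      (inter_subset_left.trans inter_subset_right)) ?_ (u x) fun y hy => hu x hx.2 y hy.1.2
    have hstrict : HasStrictFDerivAt g
        ((fderiv ℝ g x).toContinuousLinearEquivOfDetNeZero (hreg x hx.2) : E →L[ℝ] E) x := by
      rw [ContinuousLinearMap.coe_toContinuousLinearEquivOfDetNeZero]
      exact hg.contDiffAt.hasStrictFDerivAt (by simp)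
    have h1 := hstrict.map_nhds_eq_of_equiv
    have h2 : g x = 0 := hx.2
    rw [h2] at h1
    rw [← h1]
    exact image_mem_map ((hVo x hx).mem_nhds (hxV x hx))

theorem exists_hasDeg [Nontrivial E] {g : E → E} (hg : ContDiff ℝ 1 g) {W K : Set E}
    (hW : IsOpen W) (hK : IsCompact K) (hKW : K ⊆ W) {r : ℝ} (hr : 0 < r)
    (h0 : ∀ x ∈ W \ K, r ≤ ‖g x‖) : ∃ d, HasDeg μ g W d := by
  have hsard : μ (g '' {x | (fderiv ℝ g x).det = 0}) = 0 :=
    addHaar_image_eq_zero_of_det_fderivWithin_eq_zero μ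
      (fun x _ => (hg.differentiable (by simp) x).hasFDerivAt.hasFDerivWithinAt) fun x hx => hx
  obtain ⟨y, hyb, hy⟩ : ∃ y ∈ ball (0 : E) (r / 2),
      y ∉ g '' {x | (fderiv ℝ g x).det = 0} := by
    by_contra! hcon
    exact (measure_ball_pos μ (0 : E) (half_pos hr)).ne' (measure_mono_null hcon hsard)
  rw [mem_ball_zero_iff] at hyb
  have hbound : ∀ t ∈ Icc (0 : ℝ) 1, ∀ x ∈ W \ K, r / 2 ≤ ‖g x - (1 - t) • y‖ := by
    intro t ht x hx
    have h1 : ‖(1 - t) • y‖ ≤ r / 2 := by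
      rw [norm_smul, Real.norm_of_nonneg (by linarith [ht.2])]
      calc (1 - t) * ‖y‖ ≤ 1 * ‖y‖ := by gcongr; linarith [ht.1]
        _ ≤ r / 2 := by linarith
    linarith [norm_sub_norm_le (g x) ((1 - t) • y), h0 x hx]
  have hfd : ∀ x, fderiv ℝ (fun x => g x - y) x = fderiv ℝ g x := fun x => fderiv_sub_const y
  obtain ⟨d, hd⟩ := exists_hasDeg_of_regular (μ := μ) (g := fun x => g x - y)
    (hg.sub contDiff_const) hW hK hKW (half_pos hr)
    (fun x hx => by simpa using hbound 0 (by simp) x hx)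
    (fun x hx h => hy ⟨x, by rwa [hfd] at h, sub_eq_zero.1 hx⟩)
  refine ⟨d, ?_⟩
  have h1 := (hasDeg_homotopy (μ := μ) (G := fun p => g p.2 - (1 - p.1) • y) (by fun_prop) hW hK hKW
    (half_pos hr) hbound (d := d)).1 (by simpa using hd)
  simpa using h1

end Degree

section LinearIndependence

variable {J n : Type*} [Fintype J] [Fintype n]

theorem norm_sum_smul_le (v : J → ℍ[ℝ]) (A : J → n → ℍ[ℝ]) :
    ‖∑ i, v i • A i‖ ≤ Fintype.card J * ‖v‖ * ‖A‖ := by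
  calc ‖∑ i, v i • A i‖ ≤ ∑ i, ‖v i • A i‖ := norm_sum_le _ _
    _ ≤ ∑ _i : J, ‖v‖ * ‖A‖ := by
        gcongr with i
        rw [norm_smul]
        gcongr
        · exact norm_le_pi_norm v i
        · exact norm_le_pi_norm A i
    _ = _ := by simp [mul_assoc]

theorem linearIndependent_of_bound {A : J → n → ℍ[ℝ]} {δ : ℝ} (hδ : 0 < δ)
    (h : ∀ v : J → ℍ[ℝ], δ * ‖v‖ ≤ ‖∑ i, v i • A i‖) : LinearIndependent ℍ[ℝ] A := by
  rw [Fintype.linearIndependent_iff]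
  intro v hv
  have h1 := h v
  rw [hv, norm_zero] at h1
  have h2 : v = 0 := by
    rw [← norm_le_zero_iff]
    by_contra hcon
    push Not at hcon
    nlinarith
  exact fun i => congrFun h2 i

theorem exists_bound_of_linearIndependent {X : Type*} [TopologicalSpace X] {C : Set X}
    (hC : IsCompact C) {A : X → J → n → ℍ[ℝ]} (hA : ContinuousOn A C)
    (hLI : ∀ x ∈ C, LinearIndependent ℍ[ℝ] (A x)) :
    ∃ δ > 0, ∀ x ∈ C, ∀ v : J → ℍ[ℝ], δ * ‖v‖ ≤ ‖∑ i, v i • A x i‖ := by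
  have hc : IsCompact (C ×ˢ sphere (0 : J → ℍ[ℝ]) 1) := hC.prod (isCompact_sphere 0 1)
  have hcont : ContinuousOn (fun p : X × (J → ℍ[ℝ]) => ‖∑ i, p.2 i • A p.1 i‖)
      (C ×ˢ sphere (0 : J → ℍ[ℝ]) 1) := by
    refine ContinuousOn.norm (continuousOn_finsetSum _ fun i _ => ?_)
    have h1 : ContinuousOn (fun p : X × (J → ℍ[ℝ]) => A p.1) (C ×ˢ sphere (0 : J → ℍ[ℝ]) 1) :=
      hA.comp continuousOn_fst fun p hp => hp.1
    exact (by fun_prop : Continuous fun p : X × (J → ℍ[ℝ]) => p.2 i).continuousOn.smul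
      ((continuous_apply i).comp_continuousOn h1)
  obtain ⟨δ, hδ, hδb⟩ : ∃ δ > 0, ∀ p ∈ C ×ˢ sphere (0 : J → ℍ[ℝ]) 1,
      δ ≤ ‖∑ i, p.2 i • A p.1 i‖ := by
    rcases (C ×ˢ sphere (0 : J → ℍ[ℝ]) 1).eq_empty_or_nonempty with he | hne
    · exact ⟨1, one_pos, fun p hp => absurd (he ▸ hp : p ∈ (∅ : Set _)) (notMem_empty p)⟩
    · obtain ⟨p, hp, hmin⟩ := hc.exists_isMinOn hne hcont
      refine ⟨_, norm_pos_iff.2 fun h => ?_, fun q hq => hmin hq⟩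
      have h1 := Fintype.linearIndependent_iff.1 (hLI p.1 hp.1) p.2 h
      have h2 : p.2 = 0 := funext h1
      have h3 := hp.2
      rw [h2, mem_sphere_iff_norm, sub_zero, norm_zero] at h3
      exact zero_ne_one h3
  refine ⟨δ, hδ, fun x hx v => ?_⟩
  rcases eq_or_ne v 0 with rfl | hv
  · simp
  have hv0 : 0 < ‖v‖ := norm_pos_iff.2 hv
  have h1 := hδb (x, ‖v‖⁻¹ • v) ⟨hx, by
    rw [mem_sphere_iff_norm, sub_zero, norm_smul, norm_inv, norm_norm,
      inv_mul_cancel₀ hv0.ne']⟩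
  have h2 : ∑ i, (‖v‖⁻¹ • v) i • A x i = ‖v‖⁻¹ • ∑ i, v i • A x i := by
    rw [Finset.smul_sum]
    exact Finset.sum_congr rfl fun i _ => by rw [Pi.smul_apply, smul_assoc]
  simp only [h2] at h1
  rw [norm_smul, norm_inv, norm_norm, ← div_eq_inv_mul, le_div_iff₀ hv0] at h1
  exact h1

theorem exists_linearIndependent_of_norm_sub_lt {X : Type*} [TopologicalSpace X] {C : Set X}
    (hC : IsCompact C) {A : X → J → n → ℍ[ℝ]} (hA : ContinuousOn A C)
    (hLI : ∀ x ∈ C, LinearIndependent ℍ[ℝ] (A x)) :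
    ∃ ε > 0, ∀ x ∈ C, ∀ B, ‖B - A x‖ < ε → LinearIndependent ℍ[ℝ] B := by
  obtain ⟨δ, hδ, hb⟩ := exists_bound_of_linearIndependent hC hA hLI
  have hcard : (0 : ℝ) < Fintype.card J + 1 := by positivity
  refine ⟨δ / 2 / (Fintype.card J + 1), by positivity, fun x hx B hB => ?_⟩
  refine linearIndependent_of_bound (half_pos hδ) fun v => ?_
  have h1 := norm_sum_smul_le v (B - A x)
  have h2 : ∑ i, v i • (B - A x) i = ∑ i, v i • B i - ∑ i, v i • A x i := by
    rw [← Finset.sum_sub_distrib]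
    exact Finset.sum_congr rfl fun i _ => by rw [Pi.sub_apply, smul_sub]
  rw [h2] at h1
  have h3 := hb x hx v
  have h4 := norm_sub_norm_le (∑ i, v i • A x i) (∑ i, v i • B i)
  rw [norm_sub_rev] at h4
  have h5 : Fintype.card J * ‖v‖ * ‖B - A x‖ ≤ δ / 2 * ‖v‖ := by
    calc Fintype.card J * ‖v‖ * ‖B - A x‖
        ≤ (Fintype.card J + 1) * ‖v‖ * (δ / 2 / (Fintype.card J + 1)) := by
          gcongr
          linarith
      _ = δ / 2 * ‖v‖ := by field_simp
  linarith

end LinearIndependence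

section GeneralPosition

variable {I n P : Type*} [Fintype I] [Fintype n] [NormedAddCommGroup P] [NormedSpace ℝ P]
  [FiniteDimensional ℝ P]

theorem finrank_pi_quaternion (n : Type*) [Fintype n] :
    Module.finrank ℝ (n → ℍ[ℝ]) = 4 * Fintype.card n := by
  rw [Module.finrank_pi_fintype]
  simp [Quaternion.finrank_eq_four, mul_comm]

theorem finrank_pi_pi_quaternion (I n : Type*) [Fintype I] [Fintype n] :
    Module.finrank ℝ (I → n → ℍ[ℝ]) = Fintype.card I * (4 * Fintype.card n) := by
  rw [Module.finrank_pi_fintype]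
  simp [finrank_pi_quaternion]

theorem dimH_setOf_exists_sum_smul_eq_zero_lt (hP : Module.finrank ℝ P < 4 * Fintype.card n)
    {a : P → n → ℍ[ℝ]} (ha : ContDiff ℝ 1 a) {w : P → I → ℍ[ℝ]} (hw : ContDiff ℝ 1 w)
    (i₀ : I) (hi₀ : ∀ p, w p i₀ = 1) :
    dimH {B : I → n → ℍ[ℝ] | ∃ p, a p + ∑ i, w p i • B i = 0} <
      Module.finrank ℝ (I → n → ℍ[ℝ]) := by
  classical
  let Ψ : P × ({i // i ≠ i₀} → n → ℍ[ℝ]) → I → n → ℍ[ℝ] := fun q i =>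
    if h : i ≠ i₀ then q.2 ⟨i, h⟩ else -(a q.1 + ∑ j : {i // i ≠ i₀}, w q.1 j • q.2 j)
  have hΨ : ContDiff ℝ 1 Ψ := by
    rw [contDiff_pi]
    intro i
    by_cases h : i ≠ i₀
    · simp only [Ψ, dif_pos h]
      fun_prop
    · simp only [Ψ, dif_neg h]
      fun_prop
  have hsub : {B : I → n → ℍ[ℝ] | ∃ p, a p + ∑ i, w p i • B i = 0} ⊆ range Ψ := by
    rintro B ⟨p, hp⟩
    refine ⟨(p, fun j => B j), ?_⟩
    ext1 i
    by_cases h : i ≠ i₀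
    · simp only [Ψ, dif_pos h]
    · simp only [Ψ, dif_neg h]
      push Not at h
      subst h
      rw [← Finset.add_sum_erase _ _ (Finset.mem_univ i), hi₀, one_smul] at hp
      have h1 : ∑ j : {j // j ≠ i}, w p j • B j = ∑ j ∈ Finset.univ.erase i, w p j • B j := by
        rw [← Finset.sum_coe_sort (Finset.univ.erase i)]
        exact Fintype.sum_equiv (Equiv.subtypeEquivRight (by simp)) _ _ fun j => rfl
      rw [h1, neg_eq_iff_add_eq_zero, ← hp]
      abel
  refine ((dimH_mono hsub).trans hΨ.dimH_range_le).trans_lt ?_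
  rw [Module.finrank_prod, finrank_pi_pi_quaternion, finrank_pi_pi_quaternion,
    Fintype.card_subtype_compl, Fintype.card_subtype_eq]
  have h1 : 0 < Fintype.card I := Fintype.card_pos_iff.2 ⟨i₀⟩
  obtain ⟨m, hm⟩ : ∃ m, Fintype.card I = m + 1 := ⟨_, (Nat.succ_pred_eq_of_pos h1).symm⟩
  rw [hm]
  norm_cast
  rw [Nat.add_sub_cancel, add_one_mul m]
  omega

/-- A generic translation makes a smooth family of matrices with many columns have
linearly independent rows. -/
theorem dense_setOf_forall_linearIndependent_add
    (hP : Module.finrank ℝ P + 4 * Fintype.card I < 4 * Fintype.card n + 4)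
    {a : P → I → n → ℍ[ℝ]} (ha : ContDiff ℝ 1 a) :
    Dense {B : I → n → ℍ[ℝ] | ∀ p, LinearIndependent ℍ[ℝ] (a p + B)} := by
  classical
  rcases isEmpty_or_nonempty I with hI | hI
  · refine dense_univ.mono fun B _ p => linearIndependent_empty_type
  let S : I → Set (I → n → ℍ[ℝ]) := fun i₀ => {B | ∃ p : P × ({i // i ≠ i₀} → ℍ[ℝ]),
    (∑ i, (if h : i ≠ i₀ then p.2 ⟨i, h⟩ else 1) • a p.1 i) +
      ∑ i, (if h : i ≠ i₀ then p.2 ⟨i, h⟩ else 1) • B i = 0}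
  have hw : ∀ i₀ i : I, ContDiff ℝ 1 fun p : P × ({i // i ≠ i₀} → ℍ[ℝ]) =>
      if h : i ≠ i₀ then p.2 ⟨i, h⟩ else 1 := by
    intro i₀ i
    by_cases h : i ≠ i₀
    · simp only [dif_pos h]
      fun_prop
    · simp only [dif_neg h]
      fun_prop
  have hS : ∀ i₀, dimH (S i₀) < Module.finrank ℝ (I → n → ℍ[ℝ]) := by
    intro i₀
    refine dimH_setOf_exists_sum_smul_eq_zero_lt (P := P × ({i // i ≠ i₀} → ℍ[ℝ])) ?_
      (a := fun p => ∑ i, (if h : i ≠ i₀ then p.2 ⟨i, h⟩ else 1) • a p.1 i) ?_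
      (w := fun p i => if h : i ≠ i₀ then p.2 ⟨i, h⟩ else 1) (contDiff_pi.2 fun i => hw i₀ i) i₀
      (fun p => by simp)
    · rw [Module.finrank_prod, finrank_pi_quaternion, Fintype.card_subtype_compl,
        Fintype.card_subtype_eq]
      have h1 : 0 < Fintype.card I := Fintype.card_pos_iff.2 ⟨i₀⟩
      omega
    · refine ContDiff.sum fun i _ => ?_
      have := hw i₀ i
      fun_prop
  have hU : dimH (⋃ i, S i) < Module.finrank ℝ (I → n → ℍ[ℝ]) := by
    rw [dimH_iUnion]
    obtain ⟨i, hi⟩ := exists_eq_ciSup_of_finite (f := fun i => dimH (S i))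
    rw [← hi]
    exact hS i
  refine (dense_compl_of_dimH_lt_finrank hU).mono fun B hB p => ?_
  rw [Fintype.linearIndependent_iff]
  intro v hv
  by_contra! hcon
  obtain ⟨i₀, hi₀⟩ := hcon
  refine hB (mem_iUnion.2 ⟨i₀, (p, fun i => (v i₀)⁻¹ * v i), ?_⟩)
  have h1 : ∀ i, (if h : i ≠ i₀ then (v i₀)⁻¹ * v i else 1) = (v i₀)⁻¹ * v i := by
    intro i
    split_ifs with h
    · rfl
    · push Not at h
      rw [h, inv_mul_cancel₀ hi₀]
  simp only [h1]
  rw [← Finset.sum_add_distrib]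
  simp_rw [← smul_add, mul_smul]
  rw [← Finset.smul_sum]
  have h2 : ∑ i, v i • (a p i + B i) = 0 := hv
  rw [h2, smul_zero]

end GeneralPosition

section Approximation

theorem exists_contDiff_norm_sub_lt.{u, v} {E : Type u} {F : Type v} [NormedAddCommGroup E]
    [NormedSpace ℝ E] [FiniteDimensional ℝ E] [NormedAddCommGroup F] [NormedSpace ℝ F] [TietzeExtension.{u} F]
    {C : Set E} (hC : IsClosed C) {φ : E → F} (hφ : ContinuousOn φ C) {ε : ℝ} (hε : 0 < ε) :
    ∃ Φ : E → F, ContDiff ℝ 1 Φ ∧ ∀ x ∈ C, ‖Φ x - φ x‖ < ε := by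
  obtain ⟨g, hg⟩ := ContinuousMap.exists_restrict_eq hC ⟨C.domRestrict φ, hφ.domRestrict⟩
  obtain ⟨Φ, hΦ, hd, -⟩ := g.continuous.exists_contDiff_approx (ε := fun _ => ε) 1
    continuous_const fun _ => hε
  refine ⟨Φ, hΦ, fun x hx => ?_⟩
  have h1 : g x = φ x := congrArg (fun f => f ⟨x, hx⟩) hg
  rw [← h1, ← dist_eq_norm]
  exact hd x

end Approximation

section MatrixDegree

noncomputable instance : MeasurableSpace ℍ[ℝ] := borel _

instance : BorelSpace ℍ[ℝ] := ⟨rfl⟩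

variable {κ ι : Type}

/-- The open set over which the degree of a matrix map is computed. -/
def cylinder (ι : Type) (U : Set (κ → ℍ[ℝ])) : Set (κ ⊕ ι → ℍ[ℝ]) :=
  {z | (fun k => z (.inl k)) ∈ U}

theorem isOpen_cylinder {U : Set (κ → ℍ[ℝ])} (hU : IsOpen U) : IsOpen (cylinder ι U) :=
  hU.preimage (by fun_prop)

variable [Fintype ι]

/-- The affine combination of the rows of `Φ x` with coefficients `1, v` at `z = (x, v)`. -/
noncomputable def rowComb (Φ : (κ → ℍ[ℝ]) → Option ι → κ ⊕ ι → ℍ[ℝ]) (z : κ ⊕ ι → ℍ[ℝ]) :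
    κ ⊕ ι → ℍ[ℝ] :=
  Φ (fun k => z (.inl k)) none + ∑ i, z (.inr i) • Φ (fun k => z (.inl k)) (some i)

theorem rowComb_eq_sum (Φ : (κ → ℍ[ℝ]) → Option ι → κ ⊕ ι → ℍ[ℝ]) (z : κ ⊕ ι → ℍ[ℝ]) :
    rowComb Φ z = ∑ o : Option ι, (o.elim 1 fun i => z (.inr i)) •
      Φ (fun k => z (.inl k)) o := by
  simp [rowComb, Fintype.sum_option]

variable [Fintype κ]

theorem le_norm_rowComb {Φ : (κ → ℍ[ℝ]) → Option ι → κ ⊕ ι → ℍ[ℝ]} {z : κ ⊕ ι → ℍ[ℝ]} {δ : ℝ}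
    (hδ : 0 < δ) (h : ∀ v : Option ι → ℍ[ℝ], δ * ‖v‖ ≤ ‖∑ o, v o • Φ (fun k => z (.inl k)) o‖) :
    δ ≤ ‖rowComb Φ z‖ := by
  rw [rowComb_eq_sum]
  refine le_trans ?_ (h _)
  have h1 := norm_le_pi_norm (fun o : Option ι => (o.elim 1 fun i => z (.inr i))) none
  simp only [Option.elim_none, norm_one] at h1
  nlinarith

theorem exists_compact_le_norm_rowComb {U : Set (κ → ℍ[ℝ])} (hU : IsOpen U)
    (hUb : Bornology.IsBounded U) {H : ℝ × (κ → ℍ[ℝ]) → Option ι → κ ⊕ ι → ℍ[ℝ]}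
    (hH : Continuous H)
    (h1 : ∀ t ∈ Icc (0 : ℝ) 1, ∀ x ∈ closure U,
      LinearIndependent ℍ[ℝ] fun i => H (t, x) (some i))
    (h2 : ∀ t ∈ Icc (0 : ℝ) 1, ∀ x ∈ frontier U, LinearIndependent ℍ[ℝ] (H (t, x))) :
    ∃ K ⊆ {z : κ ⊕ ι → ℍ[ℝ] | (fun k => z (.inl k)) ∈ U}, IsCompact K ∧ ∃ r > 0,
      ∀ t ∈ Icc (0 : ℝ) 1, ∀ z ∈ {z : κ ⊕ ι → ℍ[ℝ] | (fun k => z (.inl k)) ∈ U} \ K,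
        r ≤ ‖rowComb (fun x => H (t, x)) z‖ := by
  have hcU : IsCompact (closure U) := hUb.isCompact_closure
  have hfU : IsCompact (frontier U) :=
    hcU.of_isClosed_subset isClosed_frontier frontier_subset_closure
  obtain ⟨δ, hδ, hδb⟩ := exists_bound_of_linearIndependent
    ((isCompact_Icc (a := (0 : ℝ)) (b := 1)).prod hfU) hH.continuousOn
    (fun p hp => h2 p.1 hp.1 p.2 hp.2)
  obtain ⟨δ', hδ', hδb'⟩ := exists_bound_of_linearIndependent
    ((isCompact_Icc (a := (0 : ℝ)) (b := 1)).prod hcU)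
    (A := fun p (i : ι) => H p (some i)) (by fun_prop)
    (fun p hp => h1 p.1 hp.1 p.2 hp.2)
  obtain ⟨M, hM⟩ : ∃ M, ∀ p ∈ Icc (0 : ℝ) 1 ×ˢ closure U, ‖H p none‖ ≤ M :=
    ((isCompact_Icc (a := (0 : ℝ)) (b := 1)).prod hcU).exists_bound_of_continuousOn
      (f := fun p => H p none) (by fun_prop)
  set R : ℝ := (M + 1) / δ' with hR
  set C₀ : Set (κ ⊕ ι → ℍ[ℝ]) :=
    {z | (fun k => z (.inl k)) ∈ closure U ∧ ‖fun i => z (.inr i)‖ ≤ R} with hC₀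
  have hC₀c : IsCompact C₀ := by
    refine Metric.isCompact_of_isClosed_isBounded ?_ ?_
    · have h1 : Continuous fun (z : κ ⊕ ι → ℍ[ℝ]) k => z (.inl k) := by fun_prop
      have h2 : Continuous fun z : κ ⊕ ι → ℍ[ℝ] => ‖fun i => z (.inr i)‖ := by fun_prop
      exact (isClosed_closure.preimage h1).inter (isClosed_le h2 continuous_const)
    · obtain ⟨ρ, hρ⟩ := hcU.isBounded.exists_norm_le
      refine isBounded_iff_forall_norm_le.2 ⟨max ρ R, fun z hz => ?_⟩
      have hR0 : 0 ≤ R := (norm_nonneg _).trans hz.2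
      refine (pi_norm_le_iff_of_nonneg (hR0.trans (le_max_right _ _))).2 fun j => ?_
      rcases j with k | i
      · exact ((norm_le_pi_norm (fun k => z (.inl k)) k).trans (hρ _ hz.1)).trans (le_max_left _ _)
      · exact ((norm_le_pi_norm (fun i => z (.inr i)) i).trans hz.2).trans (le_max_right _ _)
  have hcont : Continuous fun p : ℝ × (κ ⊕ ι → ℍ[ℝ]) => ‖rowComb (fun x => H (p.1, x)) p.2‖ := by
    unfold rowComb
    fun_prop
  refine ⟨Prod.snd '' ((Icc (0 : ℝ) 1 ×ˢ C₀) ∩ {p | ‖rowComb (fun x => H (p.1, x)) p.2‖ ≤ δ / 2}),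
    ?_, ?_, min 1 (δ / 2), lt_min one_pos (half_pos hδ), ?_⟩
  · rintro z ⟨⟨t, z'⟩, ⟨⟨ht, hz⟩, hle⟩, rfl⟩
    simp only [mem_ofPred_eq] at hle ht hz ⊢
    by_contra hcon
    have hfr : (fun k => z' (.inl k)) ∈ frontier U := by
      rw [hU.frontier_eq]
      exact ⟨hz.1, hcon⟩
    have h3 := le_norm_rowComb (Φ := fun x => H (t, x)) hδ (hδb (t, _) ⟨ht, hfr⟩)
    linarith
  · exact ((isCompact_Icc.prod hC₀c).inter_right (isClosed_le hcont continuous_const)).image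
      continuous_snd
  · rintro t ht z ⟨hzU, hzK⟩
    have hzc : (fun k => z (.inl k)) ∈ closure U := subset_closure hzU
    by_cases hv : ‖fun i => z (.inr i)‖ ≤ R
    · refine (min_le_right _ _).trans ?_
      by_contra! hlt
      exact hzK ⟨(t, z), ⟨⟨ht, hzc, hv⟩, hlt.le⟩, rfl⟩
    · refine (min_le_left _ _).trans ?_
      push Not at hv
      have h3 := hδb' (t, _) ⟨ht, hzc⟩ fun i => z (.inr i)
      have h4 := hM (t, _) ⟨ht, hzc⟩
      have h5 : M + 1 ≤ δ' * ‖fun i => z (.inr i)‖ := by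
        rw [hR, div_lt_iff₀ hδ'] at hv
        linarith
      have h6 := norm_sub_norm_le (∑ i, z (.inr i) • H (t, fun k => z (.inl k)) (some i))
        (-H (t, fun k => z (.inl k)) none)
      rw [sub_neg_eq_add, add_comm, norm_neg] at h6
      rw [rowComb]
      linarith

theorem contDiff_rowComb {P : Type*} [NormedAddCommGroup P] [NormedSpace ℝ P]
    {H : P × (κ → ℍ[ℝ]) → Option ι → κ ⊕ ι → ℍ[ℝ]} (hH : ContDiff ℝ 1 H) :
    ContDiff ℝ 1 fun p : P × (κ ⊕ ι → ℍ[ℝ]) => rowComb (fun x => H (p.1, x)) p.2 := by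
  unfold rowComb
  fun_prop



/-- `HasRowDeg Φ U d` says that `rowComb Φ` has degree `d` over the cylinder on `U`. -/
def HasRowDeg (Φ : (κ → ℍ[ℝ]) → Option ι → κ ⊕ ι → ℍ[ℝ]) (U : Set (κ → ℍ[ℝ])) (d : ℤ) : Prop :=
  HasDeg Measure.addHaar (rowComb Φ) (cylinder ι U) d

theorem hasRowDeg_homotopy {U : Set (κ → ℍ[ℝ])} (hU : IsOpen U)
    (hUb : Bornology.IsBounded U) {H : ℝ × (κ → ℍ[ℝ]) → Option ι → κ ⊕ ι → ℍ[ℝ]}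
    (hH : ContDiff ℝ 1 H)
    (h1 : ∀ t ∈ Icc (0 : ℝ) 1, ∀ x ∈ closure U,
      LinearIndependent ℍ[ℝ] fun i => H (t, x) (some i))
    (h2 : ∀ t ∈ Icc (0 : ℝ) 1, ∀ x ∈ frontier U, LinearIndependent ℍ[ℝ] (H (t, x))) {d : ℤ} :
    HasRowDeg (fun x => H (0, x)) U d ↔ HasRowDeg (fun x => H (1, x)) U d := by
  obtain ⟨K, hKU, hK, r, hr, hb⟩ := exists_compact_le_norm_rowComb hU hUb hH.continuous h1 h2
  exact hasDeg_homotopy (G := fun p => rowComb (fun x => H (p.1, x)) p.2) (contDiff_rowComb hH)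
    (isOpen_cylinder hU) hK hKU hr hb

theorem exists_hasRowDeg [Nonempty κ] {U : Set (κ → ℍ[ℝ])} (hU : IsOpen U)
    (hUb : Bornology.IsBounded U) {Φ : (κ → ℍ[ℝ]) → Option ι → κ ⊕ ι → ℍ[ℝ]}
    (hΦ : ContDiff ℝ 1 Φ)
    (h1 : ∀ x ∈ closure U, LinearIndependent ℍ[ℝ] fun i => Φ x (some i))
    (h2 : ∀ x ∈ frontier U, LinearIndependent ℍ[ℝ] (Φ x)) : ∃ d, HasRowDeg Φ U d := by
  obtain ⟨K, hKU, hK, r, hr, hb⟩ := exists_compact_le_norm_rowComb hU hUb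
    (H := fun p => Φ p.2) (hΦ.continuous.comp continuous_snd) (fun _ _ => h1) (fun _ _ => h2)
  refine exists_hasDeg ?_ (isOpen_cylinder hU) hK hKU hr (hb 0 (by simp))
  unfold rowComb
  fun_prop

theorem hasRowDeg_iff_of_linear_homotopy {U : Set (κ → ℍ[ℝ])} (hU : IsOpen U)
    (hUb : Bornology.IsBounded U) {Φ₀ Φ₁ : (κ → ℍ[ℝ]) → Option ι → κ ⊕ ι → ℍ[ℝ]}
    (hΦ₀ : ContDiff ℝ 1 Φ₀) (hΦ₁ : ContDiff ℝ 1 Φ₁)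
    (h1 : ∀ t ∈ Icc (0 : ℝ) 1, ∀ x ∈ closure U,
      LinearIndependent ℍ[ℝ] fun i => ((1 - t) • Φ₀ x + t • Φ₁ x) (some i))
    (h2 : ∀ t ∈ Icc (0 : ℝ) 1, ∀ x ∈ frontier U,
      LinearIndependent ℍ[ℝ] ((1 - t) • Φ₀ x + t • Φ₁ x)) {d : ℤ} :
    HasRowDeg Φ₀ U d ↔ HasRowDeg Φ₁ U d := by
  have := hasRowDeg_homotopy hU hUb (H := fun p => (1 - p.1) • Φ₀ p.2 + p.1 • Φ₁ p.2)
    (by fun_prop) h1 h2 (d := d)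
  simpa only [sub_zero, one_smul, zero_smul, add_zero, sub_self, zero_add] using this

theorem exists_contDiff_linearIndependent_norm_sub_lt {C : Set (κ → ℍ[ℝ])} (hC : IsClosed C)
    {φ : (κ → ℍ[ℝ]) → Option ι → κ ⊕ ι → ℍ[ℝ]} (hφ : ContinuousOn φ C) {ε : ℝ} (hε : 0 < ε) :
    ∃ Φ : (κ → ℍ[ℝ]) → Option ι → κ ⊕ ι → ℍ[ℝ], ContDiff ℝ 1 Φ ∧
      (∀ x, LinearIndependent ℍ[ℝ] fun i => Φ x (some i)) ∧ ∀ x ∈ C, ‖Φ x - φ x‖ < ε := by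
  obtain ⟨Φ, hΦ, hb⟩ := exists_contDiff_norm_sub_lt hC hφ (half_pos hε)
  have hd := dense_setOf_forall_linearIndependent_add (P := κ → ℍ[ℝ]) (I := ι) (n := κ ⊕ ι)
    (by rw [finrank_pi_quaternion, Fintype.card_sum]; omega)
    (a := fun x i => Φ x (some i)) (by fun_prop)
  obtain ⟨B, hB, hBε⟩ := hd.exists_dist_lt 0 (half_pos hε)
  rw [dist_zero_left] at hBε
  have hn : ‖(fun o => Option.elim o 0 B : Option ι → κ ⊕ ι → ℍ[ℝ])‖ ≤ ‖B‖ := by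
    refine (pi_norm_le_iff_of_nonneg (norm_nonneg _)).2 fun o => ?_
    rcases o with _ | i
    · simp
    · exact norm_le_pi_norm B i
  set B' : Option ι → κ ⊕ ι → ℍ[ℝ] := fun o => Option.elim o 0 B
  refine ⟨fun x => Φ x + B', by fun_prop, fun x => hB x, fun x hx => ?_⟩
  rw [add_sub_right_comm]
  linarith [norm_add_le (Φ x - φ x) B', hb x hx]

theorem hasRowDeg_add_const {U : Set (κ → ℍ[ℝ])} (hU : IsOpen U)
    (hUb : Bornology.IsBounded U) {Φ : (κ → ℍ[ℝ]) → Option ι → κ ⊕ ι → ℍ[ℝ]}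
    (hΦ : ContDiff ℝ 1 Φ)
    (h1 : ∀ x ∈ closure U, LinearIndependent ℍ[ℝ] fun i => Φ x (some i))
    (h2 : ∀ x ∈ frontier U, LinearIndependent ℍ[ℝ] (Φ x)) :
    ∃ ε > 0, ∀ B : Option ι → κ ⊕ ι → ℍ[ℝ], ‖B‖ < ε → ∀ d,
      HasRowDeg Φ U d ↔ HasRowDeg (fun x => Φ x + B) U d := by
  obtain ⟨ε₁, hε₁, hs₁⟩ := exists_linearIndependent_of_norm_sub_lt hUb.isCompact_closure
    (A := fun x (i : ι) => Φ x (some i))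
    (by have := hΦ.continuous; exact Continuous.continuousOn (by fun_prop)) h1
  obtain ⟨ε₂, hε₂, hs₂⟩ := exists_linearIndependent_of_norm_sub_lt
    (hUb.isCompact_closure.of_isClosed_subset isClosed_frontier frontier_subset_closure)
    hΦ.continuous.continuousOn h2
  refine ⟨min ε₁ ε₂, lt_min hε₁ hε₂, fun B hB d => ?_⟩
  have hlin : ∀ (t : ℝ) x, (1 - t) • Φ x + t • (Φ x + B) - Φ x = t • B := fun t x => by module
  have hn : ∀ t ∈ Icc (0 : ℝ) 1, ‖t • B‖ < min ε₁ ε₂ := fun t ht => by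
    rw [norm_smul, Real.norm_of_nonneg ht.1]
    exact (mul_le_of_le_one_left (norm_nonneg _) ht.2).trans_lt hB
  refine hasRowDeg_iff_of_linear_homotopy hU hUb hΦ (by fun_prop) (fun t ht x hx => ?_)
    fun t ht x hx => ?_
  · refine hs₁ x hx _ ?_
    refine lt_of_le_of_lt ?_ ((hn t ht).trans_le (min_le_left _ _))
    rw [← hlin t x]
    exact (pi_norm_le_iff_of_nonneg (norm_nonneg _)).2 fun i =>
      norm_le_pi_norm ((1 - t) • Φ x + t • (Φ x + B) - Φ x) (some i)
  · refine hs₂ x hx _ ?_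
    rw [hlin]
    exact (hn t ht).trans_le (min_le_right _ _)

theorem hasRowDeg_iff_of_norm_sub_lt {U : Set (κ → ℍ[ℝ])} (hU : IsOpen U)
    (hUb : Bornology.IsBounded U) {φ : (κ → ℍ[ℝ]) → Option ι → κ ⊕ ι → ℍ[ℝ]}
    (hφ : ContinuousOn φ (frontier U))
    (hLI : ∀ x ∈ frontier U, LinearIndependent ℍ[ℝ] (φ x)) :
    ∃ ε > 0, (∀ x ∈ frontier U, ∀ B, ‖B - φ x‖ < ε → LinearIndependent ℍ[ℝ] B) ∧
      ∀ Φ₀ Φ₁ : (κ → ℍ[ℝ]) → Option ι → κ ⊕ ι → ℍ[ℝ], ContDiff ℝ 1 Φ₀ → ContDiff ℝ 1 Φ₁ →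
      (∀ x ∈ closure U, LinearIndependent ℍ[ℝ] fun i => Φ₀ x (some i)) →
      (∀ x ∈ closure U, LinearIndependent ℍ[ℝ] fun i => Φ₁ x (some i)) →
      (∀ x ∈ frontier U, ‖Φ₀ x - φ x‖ < ε) → (∀ x ∈ frontier U, ‖Φ₁ x - φ x‖ < ε) →
      ∀ d, HasRowDeg Φ₀ U d ↔ HasRowDeg Φ₁ U d := by
  obtain ⟨ε, hε, hs⟩ := exists_linearIndependent_of_norm_sub_lt
    (hUb.isCompact_closure.of_isClosed_subset isClosed_frontier frontier_subset_closure)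
    hφ hLI
  refine ⟨ε / 2, half_pos hε, fun x hx B hB => hs x hx B (hB.trans (half_lt_self hε)),
    fun Φ₀ Φ₁ hΦ₀ hΦ₁ h₀ h₁ hd₀ hd₁ d => ?_⟩
  obtain ⟨δ₀, hδ₀, hc₀⟩ := hasRowDeg_add_const hU hUb hΦ₀ h₀
    fun x hx => hs x hx _ ((hd₀ x hx).trans (half_lt_self hε))
  obtain ⟨δ₁, hδ₁, hc₁⟩ := hasRowDeg_add_const hU hUb hΦ₁ h₁
    fun x hx => hs x hx _ ((hd₁ x hx).trans (half_lt_self hε))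
  have hdense := dense_setOf_forall_linearIndependent_add (P := ℝ × (κ → ℍ[ℝ])) (I := ι)
    (n := κ ⊕ ι) (by
      rw [Module.finrank_prod, finrank_pi_quaternion, Fintype.card_sum, Module.finrank_self]; omega)
    (a := fun p i => (1 - p.1) • Φ₀ p.2 (some i) + p.1 • Φ₁ p.2 (some i)) (by fun_prop)
  obtain ⟨B, hB, hBε⟩ := hdense.exists_dist_lt 0 (lt_min (half_pos hε) (lt_min hδ₀ hδ₁))
  rw [dist_zero_left] at hBε
  set B' : Option ι → κ ⊕ ι → ℍ[ℝ] := fun o => Option.elim o 0 B with hB'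
  have hn : ‖B'‖ ≤ ‖B‖ := by
    refine (pi_norm_le_iff_of_nonneg (norm_nonneg _)).2 fun o => ?_
    rcases o with _ | i
    · simp [hB']
    · exact norm_le_pi_norm B i
  have hlt := hn.trans_lt hBε
  rw [hc₀ B' (hlt.trans_le ((min_le_right _ _).trans (min_le_left _ _))),
    hc₁ B' (hlt.trans_le ((min_le_right _ _).trans (min_le_right _ _)))]
  have hsum : ∀ (t : ℝ) x, (1 - t) • (Φ₀ x + B') + t • (Φ₁ x + B') =
      (1 - t) • Φ₀ x + t • Φ₁ x + B' := fun t x => by module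
  refine hasRowDeg_iff_of_linear_homotopy hU hUb (by fun_prop) (by fun_prop) (fun t ht x hx => ?_)
    fun t ht x hx => ?_
  · simp only [hsum]
    exact hB (t, x)
  · rw [hsum]
    refine hs x hx _ ?_
    have h1 : (1 - t) • Φ₀ x + t • Φ₁ x + B' - φ x =
        (1 - t) • (Φ₀ x - φ x) + t • (Φ₁ x - φ x) + B' := by module
    rw [h1]
    have h2 : ‖(1 - t) • (Φ₀ x - φ x)‖ ≤ (1 - t) * (ε / 2) := by
      rw [norm_smul, Real.norm_of_nonneg (by linarith [ht.2])]
      exact mul_le_mul_of_nonneg_left (hd₀ x hx).le (by linarith [ht.2])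
    have h3 : ‖t • (Φ₁ x - φ x)‖ ≤ t * (ε / 2) := by
      rw [norm_smul, Real.norm_of_nonneg ht.1]
      exact mul_le_mul_of_nonneg_left (hd₁ x hx).le ht.1
    have h4 := norm_add₃_le (a := (1 - t) • (Φ₀ x - φ x)) (b := t • (Φ₁ x - φ x)) (c := B')
    linarith [hlt.trans_le (min_le_left _ _)]

end MatrixDegree

section StdMat

variable {κ ι : Type} [Fintype ι] [DecidableEq ι]

/-- The matrix with first row `(y, 0)` whose other rows are those of `(0, 1)`. -/
noncomputable def stdMat (ι : Type) [DecidableEq ι] (y : κ → ℍ[ℝ]) : Option ι → κ ⊕ ι → ℍ[ℝ]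
  | none => Sum.elim y 0
  | some i => Sum.elim 0 (Pi.single i 1)

theorem rowComb_stdMat (z : κ ⊕ ι → ℍ[ℝ]) : rowComb (stdMat ι) z = z := by
  ext1 j
  rcases j with k | j <;> simp [rowComb, stdMat, Finset.sum_apply, Pi.single_apply]

theorem linearIndependent_stdMat_some (y : κ → ℍ[ℝ]) :
    LinearIndependent ℍ[ℝ] fun i => stdMat ι y (some i) := by
  refine Fintype.linearIndependent_iff.2 fun v hv i => ?_
  simpa [stdMat, Finset.sum_apply, Pi.single_apply] using congrFun hv (.inr i)

theorem linearIndependent_stdMat {y : κ → ℍ[ℝ]} (hy : y ≠ 0) :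
    LinearIndependent ℍ[ℝ] (stdMat ι y) := by
  refine Fintype.linearIndependent_iff.2 fun v hv => ?_
  rw [Fintype.sum_option] at hv
  obtain ⟨k, hk⟩ := Function.ne_iff.1 hy
  intro o
  rcases o with _ | i
  · have := congrFun hv (.inl k)
    simp only [stdMat, Finset.sum_apply, Pi.add_apply, Pi.smul_apply, Sum.elim_inl, smul_eq_mul,
      Pi.zero_apply, mul_zero, Finset.sum_const_zero, add_zero, mul_eq_zero] at this
    exact this.resolve_right hk
  · simpa [stdMat, Finset.sum_apply, Pi.single_apply] using congrFun hv (.inr i)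

end StdMat

section HasMatDeg

variable {κ ι : Type} [Fintype ι] [Fintype κ]

/-- `HasMatDeg φ U d` says that every smooth map close to `φ` on the frontier of `U`, whose rows
other than the first are independent on `closure U`, has row degree `d`. -/
def HasMatDeg (φ : (κ → ℍ[ℝ]) → Option ι → κ ⊕ ι → ℍ[ℝ]) (U : Set (κ → ℍ[ℝ])) (d : ℤ) : Prop :=
  ∃ ε > 0, ∀ Φ : (κ → ℍ[ℝ]) → Option ι → κ ⊕ ι → ℍ[ℝ], ContDiff ℝ 1 Φ →
    (∀ x ∈ closure U, LinearIndependent ℍ[ℝ] fun i => Φ x (some i)) →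
    (∀ x ∈ frontier U, ‖Φ x - φ x‖ < ε) → HasRowDeg Φ U d

variable {φ ψ : (κ → ℍ[ℝ]) → Option ι → κ ⊕ ι → ℍ[ℝ]} {U : Set (κ → ℍ[ℝ])}

theorem hasMatDeg_of_hasRowDeg (hU : IsOpen U) (hUb : Bornology.IsBounded U)
    (hφ : ContDiff ℝ 1 φ) (h1 : ∀ x ∈ closure U, LinearIndependent ℍ[ℝ] fun i => φ x (some i))
    (h2 : ∀ x ∈ frontier U, LinearIndependent ℍ[ℝ] (φ x)) {d : ℤ} (hd : HasRowDeg φ U d) :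
    HasMatDeg φ U d := by
  obtain ⟨ε, hε, -, h⟩ := hasRowDeg_iff_of_norm_sub_lt hU hUb hφ.continuous.continuousOn h2
  exact ⟨ε, hε, fun Φ hΦ hΦ1 hΦ2 => (h φ Φ hφ hΦ h1 hΦ1 (by simpa using fun _ _ => hε) hΦ2 d).1 hd⟩

theorem exists_hasMatDeg [Nonempty κ] (hU : IsOpen U) (hUb : Bornology.IsBounded U)
    (hφ : ContinuousOn φ (frontier U)) (hLI : ∀ x ∈ frontier U, LinearIndependent ℍ[ℝ] (φ x)) :
    ∃ d, HasMatDeg φ U d := by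
  obtain ⟨ε, hε, hs, h⟩ := hasRowDeg_iff_of_norm_sub_lt hU hUb hφ hLI
  obtain ⟨Φ, hΦ, hΦ1, hΦ2⟩ :=
    exists_contDiff_linearIndependent_norm_sub_lt isClosed_frontier hφ hε
  obtain ⟨d, hd⟩ := exists_hasRowDeg hU hUb hΦ (fun x _ => hΦ1 x)
    (fun x hx => hs x hx _ (hΦ2 x hx))
  exact ⟨d, ε, hε, fun Ψ hΨ h1 h2 => (h Φ Ψ hΦ hΨ (fun x _ => hΦ1 x) h1 hΦ2 h2 d).1 hd⟩

theorem HasMatDeg.unique (hφ : ContinuousOn φ (frontier U)) {d d' : ℤ} (h : HasMatDeg φ U d)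
    (h' : HasMatDeg φ U d') : d = d' := by
  obtain ⟨ε, hε, h⟩ := h
  obtain ⟨ε', hε', h'⟩ := h'
  obtain ⟨Φ, hΦ, hΦ1, hΦ2⟩ :=
    exists_contDiff_linearIndependent_norm_sub_lt isClosed_frontier hφ (lt_min hε hε')
  exact HasDeg.unique
    (h Φ hΦ (fun x _ => hΦ1 x) fun x hx => (hΦ2 x hx).trans_le (min_le_left _ _))
    (h' Φ hΦ (fun x _ => hΦ1 x) fun x hx => (hΦ2 x hx).trans_le (min_le_right _ _))

theorem HasMatDeg.exists_of_norm_sub_lt {d : ℤ} (h : HasMatDeg φ U d) :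
    ∃ ε > 0, ∀ ψ : (κ → ℍ[ℝ]) → Option ι → κ ⊕ ι → ℍ[ℝ],
      (∀ x ∈ frontier U, ‖ψ x - φ x‖ < ε) → HasMatDeg ψ U d := by
  obtain ⟨ε, hε, h⟩ := h
  refine ⟨ε / 2, half_pos hε, fun ψ hψ => ⟨ε / 2, half_pos hε, fun Φ hΦ h1 h2 =>
    h Φ hΦ h1 fun x hx => ?_⟩⟩
  linarith [norm_sub_le_norm_sub_add_norm_sub (Φ x) (ψ x) (φ x), h2 x hx, hψ x hx]

theorem HasMatDeg.congr {d : ℤ} (h : HasMatDeg φ U d) (he : ∀ x ∈ frontier U, ψ x = φ x) :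
    HasMatDeg ψ U d := by
  obtain ⟨ε, hε, h⟩ := h.exists_of_norm_sub_lt
  exact h ψ fun x hx => by simpa [he x hx] using hε

theorem HasMatDeg.homotopy [Nonempty κ] (hU : IsOpen U) (hUb : Bornology.IsBounded U) {T : Type*}
    [TopologicalSpace T] {S : Set T} (hS : IsPreconnected S)
    {h : T → (κ → ℍ[ℝ]) → Option ι → κ ⊕ ι → ℍ[ℝ]}
    (hh : ContinuousOn (Function.uncurry h) (S ×ˢ frontier U))
    (hLI : ∀ t ∈ S, ∀ x ∈ frontier U, LinearIndependent ℍ[ℝ] (h t x)) {t₀ t₁ : T}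
    (ht₀ : t₀ ∈ S) (ht₁ : t₁ ∈ S) {d : ℤ} (hd : HasMatDeg (h t₀) U d) : HasMatDeg (h t₁) U d := by
  have hc : ∀ t ∈ S, ContinuousOn (h t) (frontier U) := fun t ht =>
    hh.comp (f := fun x => (t, x)) (by fun_prop) fun x hx => ⟨ht, hx⟩
  have hex : ∀ t, ∃ d, t ∈ S → HasMatDeg (h t) U d := fun t => by
    by_cases ht : t ∈ S
    · obtain ⟨d, hd⟩ := exists_hasMatDeg hU hUb (hc t ht) (hLI t ht)
      exact ⟨d, fun _ => hd⟩
    · exact ⟨0, fun h => absurd h ht⟩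
  choose D hD using hex
  have hcont : ContinuousOn D S := fun t ht => by
    obtain ⟨ε, hε, hb⟩ := (hD t ht).exists_of_norm_sub_lt
    have hev := (hUb.isCompact_closure.of_isClosed_subset isClosed_frontier
      frontier_subset_closure).eventually_forall_of_forall_eventually (x₀ := t)
      (P := fun t' x => t' ∈ S → x ∈ frontier U → ‖h t' x - h t x‖ < ε) (fun x hx => ?_)
    · refine tendsto_nhds_of_eventually_eq ?_
      filter_upwards [mem_nhdsWithin_of_mem_nhds hev, self_mem_nhdsWithin] with t' ht' hS'
      exact (hD t' hS').unique (hc t' hS') (hb _ fun x hx => ht' x hx hS' hx)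
    · have h1 : ContinuousWithinAt (fun p : T × (κ → ℍ[ℝ]) => ‖h p.1 p.2 - h t p.2‖)
          (S ×ˢ frontier U) (t, x) :=
        ((hh (t, x) ⟨ht, hx⟩).sub (((hc t ht x hx).comp (f := Prod.snd) (x := (t, x))
          continuous_snd.continuousWithinAt fun p hp => hp.2))).norm
      have h2 := h1.eventually_lt (continuousWithinAt_const (b := ε)) (by simpa using hε)
      filter_upwards [eventually_nhdsWithin_iff.1 h2] with p hp h3 h4 using hp ⟨h3, h4⟩
  have he := hS.constant hcont ht₀ ht₁
  rw [hd.unique (hc t₀ ht₀) (hD t₀ ht₀), he]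
  exact hD t₁ ht₁

theorem HasMatDeg.linear_homotopy [Nonempty κ] (hU : IsOpen U) (hUb : Bornology.IsBounded U)
    {h : ℝ → (κ → ℍ[ℝ]) → Option ι → κ ⊕ ι → ℍ[ℝ]}
    (hh : ContinuousOn (Function.uncurry h) (Icc 0 1 ×ˢ frontier U))
    (hLI : ∀ t ∈ Icc (0 : ℝ) 1, ∀ x ∈ frontier U, LinearIndependent ℍ[ℝ] (h t x)) {d : ℤ}
    (hd : HasMatDeg (h 0) U d) : HasMatDeg (h 1) U d :=
  hd.homotopy hU hUb isPreconnected_Icc hh hLI (by simp) (by simp)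

theorem hasMatDeg_sum (hU : IsOpen U) (hUb : Bornology.IsBounded U) {J : Type*} (s : Finset J)
    {V : J → Set (κ → ℍ[ℝ])} (hV : ∀ i ∈ s, IsOpen (V i)) (hVU : ∀ i ∈ s, V i ⊆ U)
    (hdisj : (s : Set J).PairwiseDisjoint V) (hφ : ContinuousOn φ (closure U \ ⋃ i ∈ s, V i))
    (hLI : ∀ x ∈ closure U \ ⋃ i ∈ s, V i, LinearIndependent ℍ[ℝ] (φ x)) {d : J → ℤ}
    (hd : ∀ i ∈ s, HasMatDeg φ (V i) (d i)) : HasMatDeg φ U (∑ i ∈ s, d i) := by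
  set C := closure U \ ⋃ i ∈ s, V i with hC
  have hCcl : IsClosed C := isClosed_closure.sdiff (isOpen_biUnion hV)
  have hCc : IsCompact C := hUb.isCompact_closure.of_isClosed_subset hCcl sdiff_subset
  have hUC : frontier U ⊆ C := fun x hx => by
    refine ⟨frontier_subset_closure hx, fun hx' => ?_⟩
    obtain ⟨i, hi, hxi⟩ := mem_iUnion₂.1 hx'
    rw [hU.frontier_eq] at hx
    exact hx.2 (hVU i hi hxi)
  have hVC : ∀ i ∈ s, frontier (V i) ⊆ C := fun i hi x hx => by
    refine ⟨closure_mono (hVU i hi) (frontier_subset_closure hx), fun hx' => ?_⟩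
    obtain ⟨j, hj, hxj⟩ := mem_iUnion₂.1 hx'
    rcases eq_or_ne i j with rfl | hij
    · rw [(hV i hi).frontier_eq] at hx
      exact hx.2 hxj
    · exact disjoint_left.1 ((hdisj hi hj hij).closure_left (hV j hj))
        (frontier_subset_closure hx) hxj
  obtain ⟨ε₀, hε₀, -, hiff⟩ := hasRowDeg_iff_of_norm_sub_lt hU hUb (hφ.mono hUC)
    fun x hx => hLI x (hUC hx)
  obtain ⟨ε₁, hε₁, hs₁⟩ := exists_linearIndependent_of_norm_sub_lt hCc hφ hLI
  obtain ⟨ε₂, hε₂, hs₂⟩ : ∃ ε > 0, ∀ i ∈ s, ∀ Φ : (κ → ℍ[ℝ]) → Option ι → κ ⊕ ι → ℍ[ℝ],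
      ContDiff ℝ 1 Φ → (∀ x, LinearIndependent ℍ[ℝ] fun i => Φ x (some i)) →
      (∀ x ∈ C, ‖Φ x - φ x‖ < ε) → HasRowDeg Φ (V i) (d i) := by
    choose! e he heb using hd
    rcases s.eq_empty_or_nonempty with rfl | hne
    · exact ⟨1, one_pos, by simp⟩
    · refine ⟨s.inf' hne e, (Finset.lt_inf'_iff hne).2 he, fun i hi Φ hΦ h1 h2 =>
        heb i hi Φ hΦ (fun x _ => h1 x) fun x hx =>
          (h2 x (hVC i hi hx)).trans_le (Finset.inf'_le e hi)⟩
  obtain ⟨Φ, hΦ, hΦ1, hΦ2⟩ := exists_contDiff_linearIndependent_norm_sub_lt hCcl hφ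
    (lt_min hε₀ (lt_min hε₁ hε₂))
  have hΦC : ∀ x ∈ C, LinearIndependent ℍ[ℝ] (Φ x) := fun x hx => hs₁ x hx _
    ((hΦ2 x hx).trans_le ((min_le_right _ _).trans (min_le_left _ _)))
  obtain ⟨K, -, hK, r, hr, hb⟩ := exists_compact_le_norm_rowComb hU hUb
    (H := fun p => Φ p.2) (hΦ.continuous.comp continuous_snd) (fun _ _ x _ => hΦ1 x)
    (fun _ _ x hx => hΦC x (hUC hx))
  obtain ⟨δ, hδ, hδb⟩ := exists_bound_of_linearIndependent hCc hΦ.continuous.continuousOn hΦC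
  have hrow : HasRowDeg Φ U (∑ i ∈ s, d i) := by
    refine hasDeg_sum (K := K) (r := min r δ) (V := fun i => cylinder ι (V i)) ?_
      (isOpen_cylinder hU) hK (lt_min hr hδ)
      (fun z hz => (min_le_left _ _).trans (hb 0 (by simp) z hz)) s
      (fun i hi => isOpen_cylinder (hV i hi)) (fun i hi z hz => hVU i hi hz)
      (fun i hi j hj hij => ?_) (fun z hz => ?_) fun i hi => ?_
    · unfold rowComb
      fun_prop
    · exact disjoint_left.2 fun z hz hz' => disjoint_left.1 (hdisj hi hj hij) hz hz'
    · refine (min_le_right _ _).trans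
        (le_norm_rowComb hδ (hδb _ ⟨subset_closure hz.1, fun h => ?_⟩))
      obtain ⟨i, hi, hxi⟩ := mem_iUnion₂.1 h
      exact hz.2 (mem_iUnion₂.2 ⟨i, hi, hxi⟩)
    · exact hs₂ i hi Φ hΦ hΦ1 fun x hx =>
        (hΦ2 x hx).trans_le ((min_le_right _ _).trans (min_le_right _ _))
  exact ⟨ε₀, hε₀, fun Ψ hΨ h1 h2 => (hiff Φ Ψ hΦ hΨ (fun x _ => hΦ1 x) h1
    (fun x hx => (hΦ2 x (hUC hx)).trans_le (min_le_left _ _)) h2 _).1 hrow⟩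

theorem HasMatDeg.excision (hU : IsOpen U) (hUb : Bornology.IsBounded U)
    {V : Set (κ → ℍ[ℝ])} (hV : IsOpen V) (hVU : V ⊆ U) (hφ : ContinuousOn φ (closure U \ V))
    (hLI : ∀ x ∈ closure U \ V, LinearIndependent ℍ[ℝ] (φ x)) {d : ℤ}
    (hd : HasMatDeg φ V d) : HasMatDeg φ U d := by
  have := hasMatDeg_sum hU hUb (J := ℕ) {0} (V := fun _ => V) (φ := φ) (d := fun _ => d)
    (fun _ _ => hV) (fun _ _ => hVU) (by simp) (by simpa using hφ) (by simpa using hLI)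
    (fun _ _ => hd)
  simpa using this

theorem contDiff_stdMat [DecidableEq ι] : ContDiff ℝ 1 (stdMat (κ := κ) ι) := by
  refine contDiff_pi.2 fun o => contDiff_pi.2 fun j => ?_
  rcases o with _ | i <;> rcases j with k | j <;> simp only [stdMat, Sum.elim_inl, Sum.elim_inr]
    <;> fun_prop

theorem hasMatDeg_stdMat [DecidableEq ι] {R : ℝ} (hR : 0 < R) :
    HasMatDeg (stdMat (κ := κ) ι) (ball 0 R) 1 := by
  refine hasMatDeg_of_hasRowDeg isOpen_ball isBounded_ball contDiff_stdMat
    (fun x _ => linearIndependent_stdMat_some x) (fun x hx => linearIndependent_stdMat ?_) ?_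
  · rintro rfl
    have := frontier_ball_subset_sphere hx
    simp at this
    exact hR.ne this
  · rw [HasRowDeg, funext rowComb_stdMat]
    refine hasDeg_id (isOpen_cylinder isOpen_ball) ?_
    simpa [cylinder, ← Pi.zero_def] using hR

end HasMatDeg

section LinearAlgebra

variable {I J : Type} [Fintype I]

theorem linearIndependent_of_vecMul {A : Matrix I J ℍ[ℝ]}
    (h : ∀ v : I → ℍ[ℝ], Matrix.vecMul v A = 0 → v = 0) : LinearIndependent ℍ[ℝ] A := by
  refine Fintype.linearIndependent_iff.2 fun v hv i => ?_
  refine congrFun (h v ?_) i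
  rw [← hv]
  ext1 j
  simp [Matrix.vecMul, dotProduct, Finset.sum_apply]

theorem eq_zero_of_vecMul_map [DecidableEq I] {K : Type*} [Field K] (f : K →+* ℍ[ℝ])
    {M : Matrix I I K} (hM : M.det ≠ 0) {v : I → ℍ[ℝ]} (h : Matrix.vecMul v (M.map f) = 0) :
    v = 0 := by
  have h1 : M.map f * M⁻¹.map f = 1 := by
    rw [← Matrix.map_mul, Matrix.mul_nonsing_inv _ (isUnit_iff_ne_zero.2 hM),
      Matrix.map_one _ (map_zero f) (map_one f)]
  rw [← Matrix.vecMul_one v, ← h1, ← Matrix.vecMul_vecMul, h, Matrix.zero_vecMul]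

theorem isPreconnected_setOf_eval_ne_zero {p : Polynomial ℂ} (hp : p ≠ 0) :
    IsPreconnected {z : ℂ | p.eval z ≠ 0} := by
  have hc : {z : ℂ | p.eval z = 0}.Countable := by
    refine ((p.roots.toFinset.finite_toSet).subset fun z hz => ?_).countable
    simpa [hp] using hz
  exact (hc.isPathConnected_compl_of_one_lt_rank
    (by rw [Complex.rank_real_complex]; norm_num)).isConnected.isPreconnected

theorem exists_polynomial_eval_eq_det [DecidableEq I] (M N : Matrix I I ℂ) :
    ∃ p : Polynomial ℂ, ∀ z, p.eval z = ((1 - z) • M + z • N).det := by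
  refine ⟨(Matrix.of fun i j => (1 - Polynomial.X) * Polynomial.C (M i j) +
    Polynomial.X * Polynomial.C (N i j)).det, fun z => ?_⟩
  rw [← Polynomial.coe_evalRingHom, RingHom.map_det]
  congr 1
  ext i j
  simp [mul_comm (N i j)]

end LinearAlgebra

section LocalModel

variable {κ ι ι' : Type}

/-- The complex matrix with constant first row on `κ` for which `localMat` is `stdMat`. -/
def stdCoeff [DecidableEq ι'] : Matrix (Option ι') (κ ⊕ ι') ℂ
  | none => Sum.elim 1 0
  | some i => Sum.elim 0 (Pi.single i 1)

/-- The columns of `V` indexed by `inl b` and `ι'`. -/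
def colMinor (V : Matrix (Option ι') (κ ⊕ ι') ℂ) (b : κ) : Matrix (Option ι') (Option ι') ℂ :=
  V.submatrix id fun o => o.elim (.inl b) .inr

theorem colMinor_stdCoeff [DecidableEq ι'] (b : κ) : colMinor (stdCoeff (ι' := ι')) b = 1 := by
  ext o o'
  rcases o with _ | i <;> rcases o' with _ | i' <;>
    simp [colMinor, stdCoeff, Matrix.one_apply, Pi.single_apply, eq_comm]

variable [Fintype ι] [Fintype κ]

theorem HasMatDeg.homotopy_comp [Nonempty κ] {U : Set (κ → ℍ[ℝ])} (hU : IsOpen U)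
    (hUb : Bornology.IsBounded U) {T : Type*} [TopologicalSpace T] {S : Set T}
    (hS : IsPreconnected S)
    {F : (Option ι' → κ ⊕ ι' → ℍ[ℝ]) → Option ι → κ ⊕ ι → ℍ[ℝ]}
    (hF : ContinuousOn F {A | LinearIndependent ℍ[ℝ] A})
    (hFLI : ∀ A, LinearIndependent ℍ[ℝ] A → LinearIndependent ℍ[ℝ] (F A))
    {h : T → (κ → ℍ[ℝ]) → Option ι' → κ ⊕ ι' → ℍ[ℝ]}
    (hh : Continuous (Function.uncurry h))
    (hLI : ∀ t ∈ S, ∀ x ∈ frontier U, LinearIndependent ℍ[ℝ] (h t x)) {t₀ t₁ : T}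
    (ht₀ : t₀ ∈ S) (ht₁ : t₁ ∈ S) {d : ℤ} (hd : HasMatDeg (fun x => F (h t₀ x)) U d) :
    HasMatDeg (fun x => F (h t₁ x)) U d :=
  HasMatDeg.homotopy hU hUb hS (h := fun t x => F (h t x))
    (hF.comp hh.continuousOn fun p hp => hLI p.1 hp.1 p.2 hp.2)
    (fun t ht x hx => hFLI _ (hLI t ht x hx)) ht₀ ht₁ hd

variable [Fintype ι'] [DecidableEq ι'] [DecidableEq κ]

/-- The map `y ↦ V · diag(y e, 1) · Q` into quaternionic matrices. -/
noncomputable def localMat (V : Matrix (Option ι') (κ ⊕ ι') ℂ) (e : Matrix κ κ ℂ)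
    (Q : Matrix (κ ⊕ ι') (κ ⊕ ι') ℂ) (y : κ → ℍ[ℝ]) : Matrix (Option ι') (κ ⊕ ι') ℍ[ℝ] :=
  let D : Matrix (κ ⊕ ι') (κ ⊕ ι') ℍ[ℝ] :=
    Matrix.diagonal (Sum.elim (Matrix.vecMul y (e.map Quaternion.ofComplex)) 1)
  V.map Quaternion.ofComplex * D * Q.map Quaternion.ofComplex

theorem linearIndependent_localMat {V : Matrix (Option ι') (κ ⊕ ι') ℂ} {e : Matrix κ κ ℂ}
    {Q : Matrix (κ ⊕ ι') (κ ⊕ ι') ℂ} (hV : ∀ b, (colMinor V b).det ≠ 0) (he : e.det ≠ 0)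
    (hQ : Q.det ≠ 0) {y : κ → ℍ[ℝ]} (hy : y ≠ 0) : LinearIndependent ℍ[ℝ] (localMat V e Q y) := by
  refine linearIndependent_of_vecMul fun v hv => ?_
  rw [localMat, ← Matrix.vecMul_vecMul, ← Matrix.vecMul_vecMul] at hv
  have h1 := eq_zero_of_vecMul_map (Quaternion.ofComplex : ℂ →+* ℍ[ℝ]) hQ hv
  obtain ⟨b, hb⟩ : ∃ b, Matrix.vecMul y (e.map Quaternion.ofComplex) b ≠ 0 := by
    by_contra! hcon
    exact hy (eq_zero_of_vecMul_map (Quaternion.ofComplex : ℂ →+* ℍ[ℝ]) he (funext hcon))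
  refine eq_zero_of_vecMul_map (Quaternion.ofComplex : ℂ →+* ℍ[ℝ]) (hV b) (funext fun o => ?_)
  rcases o with _ | i
  · have h2 := congrFun h1 (.inl b)
    rw [Matrix.vecMul_diagonal] at h2
    exact (mul_eq_zero.1 h2).resolve_right hb
  · have h2 := congrFun h1 (.inr i)
    rw [Matrix.vecMul_diagonal, Sum.elim_inr, Pi.one_apply, mul_one] at h2
    exact h2

theorem localMat_stdCoeff (y : κ → ℍ[ℝ]) : localMat (stdCoeff (ι' := ι')) 1 1 y = stdMat ι' y := by
  have h : localMat (stdCoeff (ι' := ι')) 1 1 y = Matrix.of fun o j =>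
      Quaternion.ofComplex (stdCoeff (ι' := ι') (κ := κ) o j) * Sum.elim y 1 j := by
    rw [localMat, Matrix.map_one _ (map_zero _) (map_one _),
      Matrix.map_one _ (map_zero _) (map_one _), Matrix.vecMul_one, Matrix.mul_one]
    ext1 o j
    rw [Matrix.mul_diagonal, Matrix.map_apply, Matrix.of_apply]
  rw [h]
  funext o j
  rw [Matrix.of_apply]
  rcases o with _ | i <;> rcases j with k | j <;>
    simp [stdCoeff, stdMat, Pi.single_apply, apply_ite]

theorem continuous_localMat {V : ℂ → Matrix (Option ι') (κ ⊕ ι') ℂ} {e : ℂ → Matrix κ κ ℂ}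
    {Q : ℂ → Matrix (κ ⊕ ι') (κ ⊕ ι') ℂ} (hV : Continuous V) (he : Continuous e)
    (hQ : Continuous Q) :
    Continuous fun p : ℂ × (κ → ℍ[ℝ]) => localMat (V p.1) (e p.1) (Q p.1) p.2 := by
  have hc : Continuous Quaternion.ofComplex :=
    Quaternion.ofComplex.toLinearMap.continuous_of_finiteDimensional
  unfold localMat
  refine Continuous.matrix_mul (((hV.comp continuous_fst).matrix_map hc).matrix_mul
    (Continuous.matrix_diagonal ?_)) ((hQ.comp continuous_fst).matrix_map hc)
  refine continuous_pi fun j => ?_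
  rcases j with k | j
  · exact (continuous_apply k).comp (Continuous.matrix_vecMul continuous_snd
      ((he.comp continuous_fst).matrix_map hc))
  · exact continuous_const

theorem HasMatDeg.localMat [Nonempty κ] {U : Set (κ → ℍ[ℝ])} (hU : IsOpen U)
    (hUb : Bornology.IsBounded U) {x₀ : κ → ℍ[ℝ]} (hx₀ : x₀ ∈ U)
    {F : (Option ι' → κ ⊕ ι' → ℍ[ℝ]) → Option ι → κ ⊕ ι → ℍ[ℝ]}
    (hF : ContinuousOn F {A | LinearIndependent ℍ[ℝ] A})
    (hFLI : ∀ A, LinearIndependent ℍ[ℝ] A → LinearIndependent ℍ[ℝ] (F A))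
    {V : Matrix (Option ι') (κ ⊕ ι') ℂ} {e : Matrix κ κ ℂ}
    {Q : Matrix (κ ⊕ ι') (κ ⊕ ι') ℂ} (hV : ∀ b, (colMinor V b).det ≠ 0) (he : e.det ≠ 0)
    (hQ : Q.det ≠ 0) {d : ℤ} (hd : HasMatDeg (fun x => F (stdMat ι' (x - x₀))) U d) :
    HasMatDeg (fun x => F (localMat V e Q (x - x₀))) U d := by
  obtain ⟨pe, hpe⟩ := exists_polynomial_eval_eq_det 1 e
  obtain ⟨pQ, hpQ⟩ := exists_polynomial_eval_eq_det 1 Q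
  choose pV hpV using fun b => exists_polynomial_eval_eq_det (colMinor (stdCoeff (ι' := ι')) b)
    (colMinor V b)
  have h0 : ∀ z, (pe * pQ * ∏ b, pV b).eval z ≠ 0 ↔ ((1 - z) • 1 + z • e).det ≠ 0 ∧
      ((1 - z) • 1 + z • Q).det ≠ 0 ∧ ∀ b, (colMinor ((1 - z) • stdCoeff + z • V) b).det ≠ 0 := by
    intro z
    rw [Polynomial.eval_mul, Polynomial.eval_mul, Polynomial.eval_prod, mul_ne_zero_iff,
      mul_ne_zero_iff, Finset.prod_ne_zero_iff, hpe, hpQ, and_assoc]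
    simp only [Finset.mem_univ, true_implies, hpV]
    rfl
  have hz0 : (pe * pQ * ∏ b, pV b).eval 0 ≠ 0 := (h0 0).2 (by simp [colMinor_stdCoeff])
  have hz1 : (pe * pQ * ∏ b, pV b).eval 1 ≠ 0 := (h0 1).2 (by simpa using ⟨he, hQ, hV⟩)
  have hne : pe * pQ * ∏ b, pV b ≠ 0 := fun h => by simp [h] at hz0
  have := HasMatDeg.homotopy_comp hU hUb (isPreconnected_setOf_eval_ne_zero hne) hF hFLI
    (h := fun z x => BrouwerDegree.localMat ((1 - z) • stdCoeff + z • V) ((1 - z) • 1 + z • e)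
      ((1 - z) • 1 + z • Q) (x - x₀)) ?_ (fun z hz x hx => ?_) hz0 hz1 (d := d) ?_
  · simpa using this
  · exact (continuous_localMat (V := fun z => (1 - z) • stdCoeff + z • V)
      (e := fun z => (1 - z) • 1 + z • e) (Q := fun z => (1 - z) • 1 + z • Q) (by fun_prop)
      (by fun_prop) (by fun_prop)).comp (g := fun p => BrouwerDegree.localMat _ _ _ p.2)
      (f := fun p : ℂ × (κ → ℍ[ℝ]) => (p.1, p.2 - x₀)) (by fun_prop)
  · obtain ⟨h1, h2, h3⟩ := (h0 z).1 hz
    refine linearIndependent_localMat h3 h1 h2 (sub_ne_zero.2 ?_)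
    rintro rfl
    rw [hU.frontier_eq] at hx
    exact hx.2 hx₀
  · simpa [localMat_stdCoeff] using hd

end LocalModel

section Vandermonde

variable {c k : ℕ}

/-- The exponent attached to a row of the Vandermonde-type matrices below. -/
def rowExp (o : Option (Fin k)) : ℕ := (finSuccEquiv k).symm o

theorem det_rowExp_ne_zero {K : Type*} [Field K] {τ : Option (Fin k) → K}
    (hτ : Function.Injective τ) : (Matrix.of fun o o' => τ o' ^ rowExp o).det ≠ 0 := by
  have h := Matrix.det_vandermonde_ne_zero_iff.2 (hτ.comp (finSuccEquiv k).injective)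
  rw [← Matrix.det_transpose, ← Matrix.det_submatrix_equiv_self (finSuccEquiv k).symm] at h
  convert h using 2
  ext o o'
  simp [rowExp, Matrix.vandermonde_apply]

theorem det_pow_ne_zero {K : Type*} [Field K] {τ : Fin c → K}
    (hτ : Function.Injective τ) : (Matrix.of fun a b : Fin c => τ b ^ (a : ℕ)).det ≠ 0 := by
  have h := Matrix.det_vandermonde_ne_zero_iff.2 hτ
  rw [← Matrix.det_transpose] at h
  exact h

variable {t : Fin c ⊕ Fin k → ℝ}

theorem linearIndependent_pow_smul (ht : Function.Injective t) {w : Fin c ⊕ Fin k → ℍ[ℝ]}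
    {S : Finset (Fin c ⊕ Fin k)} (hw : ∀ j ∉ S, w j ≠ 0) (hS : S.card < c) :
    LinearIndependent ℍ[ℝ] fun (o : Option (Fin k)) j => t j ^ rowExp o • w j := by
  have hcard : Fintype.card (Option (Fin k)) ≤ Fintype.card (Sᶜ : Finset (Fin c ⊕ Fin k)) := by
    rw [Fintype.card_option, Fintype.card_fin, Fintype.card_coe, Finset.card_compl,
      Fintype.card_sum, Fintype.card_fin, Fintype.card_fin]
    omega
  obtain ⟨q⟩ := Function.Embedding.nonempty_of_card_le hcard
  refine linearIndependent_of_vecMul fun v hv => ?_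
  have hτ : Function.Injective fun o => t (q o) :=
    ht.comp (Subtype.val_injective.comp q.injective)
  refine eq_zero_of_vecMul_map (algebraMap ℝ ℍ[ℝ]) (det_rowExp_ne_zero hτ) (funext fun o' => ?_)
  have h := congrFun hv (q o')
  have hwq := hw (q o') (Finset.mem_compl.1 (q o').2)
  have h2 : (∑ o, v o * algebraMap ℝ ℍ[ℝ] (t (q o') ^ rowExp o)) * w (q o') = 0 := by
    refine Eq.trans ?_ h
    rw [Finset.sum_mul]
    simp only [Matrix.vecMul, dotProduct, Algebra.smul_def, mul_assoc]
  exact (mul_eq_zero.1 h2).resolve_right hwq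

/-- The value at the node `t j` of the polynomial with coefficients `x`. -/
noncomputable def evalAt (t : Fin c ⊕ Fin k → ℝ) (x : Fin c → ℍ[ℝ]) (j : Fin c ⊕ Fin k) : ℍ[ℝ] :=
  ∑ a : Fin c, t j ^ (a : ℕ) • x a

theorem eq_zero_of_evalAt (ht : Function.Injective t) {S : Finset (Fin c ⊕ Fin k)}
    (hS : S.card = c) {x : Fin c → ℍ[ℝ]} (hx : ∀ j ∈ S, evalAt t x j = 0) : x = 0 := by
  have e := (S.equivFinOfCardEq hS).symm
  have hτ : Function.Injective fun b => t (e b) :=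
    ht.comp (Subtype.val_injective.comp e.injective)
  refine eq_zero_of_vecMul_map (algebraMap ℝ ℍ[ℝ]) (det_pow_ne_zero hτ) (funext fun b => ?_)
  have h := hx (e b) (e b).2
  rw [Pi.zero_apply, ← h, evalAt]
  change ∑ a, x a * algebraMap ℝ ℍ[ℝ] (t (e b) ^ (a : ℕ)) = _
  exact Finset.sum_congr rfl fun a _ => by rw [Algebra.smul_def, Algebra.commutes]

/-- The monic polynomial vanishing at the nodes indexed by `S`. -/
noncomputable def nodePoly (t : Fin c ⊕ Fin k → ℝ) (S : Finset (Fin c ⊕ Fin k)) :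
    Polynomial ℝ :=
  ∏ i ∈ S, (Polynomial.X - Polynomial.C (t i))

/-- The lower coefficients of `nodePoly t S`. -/
noncomputable def nodeCoeff (t : Fin c ⊕ Fin k → ℝ) (S : Finset (Fin c ⊕ Fin k)) :
    Fin c → ℍ[ℝ] :=
  fun a => ((nodePoly t S).coeff a : ℝ)

theorem evalAt_nodeCoeff {S : Finset (Fin c ⊕ Fin k)} (hS : S.card = c) (j : Fin c ⊕ Fin k) :
    evalAt t (nodeCoeff t S) j + ((t j ^ c : ℝ) : ℍ[ℝ]) =
      (((nodePoly t S).eval (t j) : ℝ) : ℍ[ℝ]) := by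
  have hdeg : (nodePoly t S).natDegree = c := by
    rw [nodePoly, Polynomial.natDegree_finsetProd_X_sub_C_eq_card, hS]
  have hmon : (nodePoly t S).Monic :=
    Polynomial.monic_prod_of_monic _ _ fun i _ => Polynomial.monic_X_sub_C (t i)
  rw [Polynomial.Monic, Polynomial.leadingCoeff, hdeg] at hmon
  rw [Polynomial.eval_eq_sum_range, hdeg, Finset.sum_range_succ, hmon, one_mul, Finset.sum_range]
  simp only [evalAt, nodeCoeff, Quaternion.coe_add]
  congr 1
  refine Eq.trans (Finset.sum_congr rfl fun a _ => ?_) (map_sum (algebraMap ℝ ℍ[ℝ]) _ _).symm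
  rw [map_mul, ← Algebra.commutes, Algebra.smul_def]
  rfl

theorem eval_nodePoly_eq_zero_iff (ht : Function.Injective t) {S : Finset (Fin c ⊕ Fin k)}
    {j : Fin c ⊕ Fin k} : (nodePoly t S).eval (t j) = 0 ↔ j ∈ S := by
  rw [nodePoly, Polynomial.eval_prod, Finset.prod_eq_zero_iff]
  simp [sub_eq_zero, ht.eq_iff]

/-- The quaternionic matrices `V · diag(w)` with `V` a Vandermonde matrix and `w` the values of
the polynomial with lower coefficients `x` and leading coefficient `s`. -/
noncomputable def vdm (t : Fin c ⊕ Fin k → ℝ) (s : ℝ) (x : Fin c → ℍ[ℝ]) :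
    Option (Fin k) → Fin c ⊕ Fin k → ℍ[ℝ] :=
  fun o j => t j ^ rowExp o • (evalAt t x j + ((s * t j ^ c : ℝ) : ℍ[ℝ]))

theorem evalAt_add (x y : Fin c → ℍ[ℝ]) (j : Fin c ⊕ Fin k) :
    evalAt t (x + y) j = evalAt t x j + evalAt t y j := by
  simp [evalAt, Finset.sum_add_distrib]

theorem evalAt_smul (r : ℝ) (x : Fin c → ℍ[ℝ]) (j : Fin c ⊕ Fin k) :
    evalAt t (r • x) j = r • evalAt t x j := by
  simp only [evalAt, Finset.smul_sum, Pi.smul_apply]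
  exact Finset.sum_congr rfl fun a _ => smul_comm (t j ^ (a : ℕ)) r (x a)

theorem evalAt_sub (x y : Fin c → ℍ[ℝ]) (j : Fin c ⊕ Fin k) :
    evalAt t (x - y) j = evalAt t x j - evalAt t y j := by
  simp [evalAt, smul_sub]

theorem linearIndependent_vdm (ht : Function.Injective t) {s : ℝ} {x : Fin c → ℍ[ℝ]}
    (hx : ∀ S : Finset (Fin c ⊕ Fin k), S.card = c → x ≠ s • nodeCoeff t S) :
    LinearIndependent ℍ[ℝ] (vdm t s x) := by
  classical
  by_contra hcon
  set Z : Finset (Fin c ⊕ Fin k) :=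
    {j | evalAt t x j + ((s * t j ^ c : ℝ) : ℍ[ℝ]) = 0} with hZ
  have hcard : c ≤ Z.card := by
    by_contra! hlt
    exact hcon (linearIndependent_pow_smul ht (S := Z) (fun j hj => by simpa [hZ] using hj) hlt)
  obtain ⟨S, hSZ, hS⟩ := Finset.exists_subset_card_eq hcard
  refine hx S hS (sub_eq_zero.1 (eq_zero_of_evalAt ht hS fun j hj => ?_))
  have h1 : evalAt t x j + ((s * t j ^ c : ℝ) : ℍ[ℝ]) = 0 := by
    simpa [hZ] using hSZ hj
  have h2 := evalAt_nodeCoeff (t := t) hS j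
  rw [(eval_nodePoly_eq_zero_iff ht).2 hj, Quaternion.coe_zero] at h2
  rw [evalAt_sub, evalAt_smul, eq_neg_of_add_eq_zero_left h1, eq_neg_of_add_eq_zero_left h2,
    Quaternion.coe_mul, smul_neg, Quaternion.coe_mul_eq_smul]
  simp

theorem continuous_evalAt {X : Type*} [TopologicalSpace X] {x : X → Fin c → ℍ[ℝ]}
    (hx : Continuous x) (j : Fin c ⊕ Fin k) : Continuous fun p => evalAt t (x p) j := by
  unfold evalAt
  fun_prop

theorem continuous_vdm : Continuous (Function.uncurry (vdm t)) := by
  unfold Function.uncurry vdm evalAt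
  have := Quaternion.continuous_coe
  fun_prop

end Vandermonde

section Count

variable {c k : ℕ} {ι : Type} [Fintype ι] {t : Fin c ⊕ Fin k → ℝ}
  {F : (Option (Fin k) → Fin c ⊕ Fin k → ℍ[ℝ]) → Option ι → Fin c ⊕ ι → ℍ[ℝ]}

theorem exists_localMat_eq (ht : Function.Injective t) {S : Finset (Fin c ⊕ Fin k)}
    (hS : S.card = c) : ∃ (V : Matrix (Option (Fin k)) (Fin c ⊕ Fin k) ℂ)
      (e : Matrix (Fin c) (Fin c) ℂ) (Q : Matrix (Fin c ⊕ Fin k) (Fin c ⊕ Fin k) ℂ),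
      (∀ b, (colMinor V b).det ≠ 0) ∧ e.det ≠ 0 ∧ Q.det ≠ 0 ∧ ∀ y, localMat V e Q y =
        fun o j => t j ^ rowExp o • ((if j ∈ S then (1 : ℝ) else 0) • evalAt t y j +
          (((nodePoly t S).eval (t j) : ℝ) : ℍ[ℝ])) := by
  have e₁ : Fin c ≃ {j // j ∈ S} := (S.equivFinOfCardEq hS).symm
  have e₂ : Fin k ≃ {j // ¬ j ∈ S} := by
    refine (Fintype.equivFinOfCardEq ?_).symm
    rw [Fintype.card_subtype_compl, Fintype.card_coe, hS]
    simp
  set ρ : Fin c ⊕ Fin k ≃ Fin c ⊕ Fin k := (e₁.sumCongr e₂).trans (Equiv.sumCompl (· ∈ S)) with hρ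
  have hρl : ∀ b, ρ (.inl b) ∈ S := fun b => by simp [hρ]
  have hρr : ∀ i, ρ (.inr i) ∉ S := fun i => by simpa [hρ] using (e₂ i).2
  have htc : Function.Injective fun j => ((t j : ℝ) : ℂ) := Complex.ofReal_injective.comp ht
  set p : Fin c ⊕ Fin k → ℝ := Sum.elim 1 fun i => (nodePoly t S).eval (t (ρ (.inr i))) with hp
  have hpne : ∀ j, p j ≠ 0 := by
    rintro (b | i)
    · simp [hp]
    · exact fun h => hρr i ((eval_nodePoly_eq_zero_iff ht).1 h)
  refine ⟨Matrix.of fun o j => ((p j : ℝ) : ℂ) * (t (ρ j) : ℂ) ^ rowExp o,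
    Matrix.of fun a b => (t (ρ (.inl b)) : ℂ) ^ (a : ℕ),
    (1 : Matrix _ _ ℂ).submatrix ρ id, fun b => ?_, ?_, ?_, fun y => ?_⟩
  · set g : Option (Fin k) → Fin c ⊕ Fin k := fun o => o.elim (.inl b) .inr with hg
    have hgi : Function.Injective g := by
      rintro (_ | i) (_ | i') h <;> simp_all
    have h := det_rowExp_ne_zero (τ := fun o => (t (ρ (g o)) : ℂ))
      (htc.comp (ρ.injective.comp hgi))
    have h2 := Matrix.det_mul_row (fun o => ((p (g o) : ℝ) : ℂ))
      (Matrix.of fun o o' => (t (ρ (g o')) : ℂ) ^ rowExp o)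
    have h3 : (colMinor (Matrix.of fun o j => ((p j : ℝ) : ℂ) * (t (ρ j) : ℂ) ^ rowExp o) b).det =
        (∏ o, ((p (g o) : ℝ) : ℂ)) *
          (Matrix.of fun o o' => (t (ρ (g o')) : ℂ) ^ rowExp o).det := h2
    rw [h3]
    exact mul_ne_zero (Finset.prod_ne_zero_iff.2 fun o _ => Complex.ofReal_ne_zero.2 (hpne _)) h
  · exact det_pow_ne_zero (htc.comp (ρ.injective.comp Sum.inl_injective))
  · rw [Matrix.det_permute, Matrix.det_one, mul_one]
    simp
  · funext o j
    obtain ⟨j, rfl⟩ := ρ.surjective j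
    have hreal : ∀ r : ℝ, Quaternion.ofComplex (r : ℂ) = (r : ℍ[ℝ]) := fun r => by
      simp
    have h1 : ∀ A : Matrix (Option (Fin k)) (Fin c ⊕ Fin k) ℍ[ℝ],
        (A * ((1 : Matrix _ _ ℂ).submatrix ρ id).map Quaternion.ofComplex) o (ρ j) = A o j := by
      intro A
      simp [Matrix.mul_apply, Matrix.one_apply, apply_ite]
    rw [localMat]
    refine (h1 _).trans ?_
    rw [Matrix.mul_diagonal, Matrix.map_apply, Matrix.of_apply, ← Complex.ofReal_pow,
      ← Complex.ofReal_mul, hreal]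
    rcases j with b | i
    · rw [if_pos (hρl b), (eval_nodePoly_eq_zero_iff ht).2 (hρl b)]
      simp only [hp, Sum.elim_inl, Pi.one_apply, one_mul, one_smul, Quaternion.coe_zero, add_zero]
      rw [Quaternion.coe_mul_eq_smul]
      congr 1
      simp only [Matrix.vecMul, dotProduct, evalAt, Matrix.map_apply, Matrix.of_apply,
        ← Complex.ofReal_pow, hreal, Quaternion.mul_coe_eq_smul]
    · rw [if_neg (hρr i)]
      simp only [hp, Sum.elim_inr, Pi.one_apply, mul_one, zero_smul, zero_add]
      rw [← Quaternion.coe_mul_eq_smul, ← Quaternion.coe_mul, mul_comm]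

theorem hasMatDeg_comp_vdm_ball [NeZero c] (ht : Function.Injective t)
    (hF : ContinuousOn F {A | LinearIndependent ℍ[ℝ] A})
    (hFLI : ∀ A, LinearIndependent ℍ[ℝ] A → LinearIndependent ℍ[ℝ] (F A))
    {S : Finset (Fin c ⊕ Fin k)} (hS : S.card = c) {R ε : ℝ} (hε : 0 < ε)
    (hb : closedBall (nodeCoeff t S) ε ⊆ ball 0 R)
    (hw : ∀ j ∉ S, ∀ x ∈ closedBall (nodeCoeff t S) ε,
      evalAt t x j + ((t j ^ c : ℝ) : ℍ[ℝ]) ≠ 0) {d : ℤ}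
    (hd : HasMatDeg (fun x => F (stdMat (Fin k) x)) (ball 0 R) d) :
    HasMatDeg (fun x => F (vdm t 1 x)) (ball (nodeCoeff t S) ε) d := by
  set x₀ := nodeCoeff t S with hx₀
  have hmem : x₀ ∈ ball x₀ ε := mem_ball_self hε
  have hbsub : ball x₀ ε ⊆ ball 0 R := ball_subset_closedBall.trans hb
  have hstd : Continuous (stdMat (κ := Fin c) (Fin k)) := contDiff_stdMat.continuous
  have hne : ∀ x ∉ ball x₀ ε, x - x₀ ≠ 0 := by
    rintro x hx h
    rw [sub_eq_zero.1 h] at hx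
    exact hx hmem
  have hfr : ∀ x ∈ frontier (ball x₀ ε), x ∉ ball x₀ ε := fun x hx => by
    rw [isOpen_ball.frontier_eq] at hx
    exact hx.2
  have h1 : HasMatDeg (fun x => F (stdMat (Fin k) (x - x₀))) (ball 0 R) d := by
    have := HasMatDeg.homotopy_comp isOpen_ball isBounded_ball (isPreconnected_Icc (a := (0 : ℝ))
      (b := 1)) hF hFLI (U := ball 0 R) (h := fun τ x => stdMat (Fin k) (x - τ • x₀))
      (t₀ := 0) (t₁ := 1) (d := d) ?_ ?_ (by simp) (by simp) (by simpa using hd)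
    · simpa using this
    · exact hstd.comp (f := fun p : ℝ × (Fin c → ℍ[ℝ]) => p.2 - p.1 • x₀) (by fun_prop)
    · intro τ hτ x hx
      refine linearIndependent_stdMat fun h => ?_
      rw [isOpen_ball.frontier_eq] at hx
      refine hx.2 ?_
      rw [sub_eq_zero.1 h]
      have h2 := hbsub hmem
      rw [mem_ball_zero_iff] at h2 ⊢
      rw [norm_smul, Real.norm_of_nonneg hτ.1]
      exact (mul_le_of_le_one_left (norm_nonneg _) hτ.2).trans_lt h2
  have h2 : HasMatDeg (fun x => F (stdMat (Fin k) (x - x₀))) (ball x₀ ε) d := by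
    have hcont : ContinuousOn (fun x => F (stdMat (Fin k) (x - x₀))) (ball x₀ ε)ᶜ :=
      hF.comp (hstd.comp (by fun_prop : Continuous fun x => x - x₀)).continuousOn
        fun x hx => linearIndependent_stdMat (hne x hx)
    have hLI : ∀ x ∈ (ball x₀ ε)ᶜ, LinearIndependent ℍ[ℝ] (F (stdMat (Fin k) (x - x₀))) :=
      fun x hx => hFLI _ (linearIndependent_stdMat (hne x hx))
    obtain ⟨d', hd'⟩ := exists_hasMatDeg isOpen_ball isBounded_ball (hcont.mono hfr)
      fun x hx => hLI x (hfr x hx)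
    have h3 := HasMatDeg.excision isOpen_ball isBounded_ball isOpen_ball hbsub
      (hcont.mono fun x hx => hx.2) (fun x hx => hLI x hx.2) hd'
    rwa [h1.unique (hcont.mono fun x hx => ?_) h3]
    rw [isOpen_ball.frontier_eq] at hx
    exact fun h => hx.2 (hbsub h)
  obtain ⟨V, e, Q, hV, he, hQ, heq⟩ := exists_localMat_eq ht hS
  have h3 := HasMatDeg.localMat isOpen_ball isBounded_ball hmem hF hFLI hV he hQ h2
  have := HasMatDeg.homotopy_comp isOpen_ball isBounded_ball (isPreconnected_Icc (a := (0 : ℝ))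
    (b := 1)) hF hFLI (U := ball x₀ ε) (h := fun τ x o j =>
      t j ^ rowExp o • ((if j ∈ S then (1 : ℝ) else τ) • evalAt t (x - x₀) j +
          (((nodePoly t S).eval (t j) : ℝ) : ℍ[ℝ])))
    (t₀ := 0) (t₁ := 1) (d := d) ?_ ?_ (by simp) (by simp) (by simpa only [heq] using h3)
  · have h4 : ∀ x, vdm t 1 x = fun o j => t j ^ rowExp o • ((if j ∈ S then (1 : ℝ) else 1) •
        evalAt t (x - x₀) j + (((nodePoly t S).eval (t j) : ℝ) : ℍ[ℝ])) := fun x => by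
      funext o j
      rw [vdm, ← evalAt_nodeCoeff hS, ite_self, one_smul, one_mul, evalAt_sub]
      congr 1
      abel
    simpa only [h4] using this
  · refine continuous_pi fun o => continuous_pi fun j => ?_
    have h5 := continuous_evalAt (t := t)
      (by fun_prop : Continuous fun p : ℝ × (Fin c → ℍ[ℝ]) => p.2 - x₀) j
    simp only [Function.uncurry]
    split_ifs <;> fun_prop
  · intro τ hτ x hx
    classical
    have hval : ∀ j, τ • evalAt t (x - x₀) j + (((nodePoly t S).eval (t j) : ℝ) : ℍ[ℝ]) =
        evalAt t (x₀ + τ • (x - x₀)) j + ((t j ^ c : ℝ) : ℍ[ℝ]) := fun j => by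
      rw [← evalAt_nodeCoeff hS, evalAt_add, evalAt_smul]
      abel
    obtain ⟨j₀, hj₀, hj₀'⟩ : ∃ j ∈ S, evalAt t (x - x₀) j ≠ 0 := by
      by_contra! hcon
      exact hne x (hfr x hx) (eq_zero_of_evalAt ht hS hcon)
    refine linearIndependent_pow_smul ht (S := S.erase j₀) (fun j hj => ?_)
      ((Finset.card_erase_lt_of_mem hj₀).trans_eq hS)
    by_cases hjS : j ∈ S
    · have : j = j₀ := by
        by_contra h
        exact hj (Finset.mem_erase.2 ⟨h, hjS⟩)
      subst this
      simpa [hjS, (eval_nodePoly_eq_zero_iff ht).2 hjS] using hj₀'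
    · rw [if_neg hjS, hval]
      refine hw j hjS _ ?_
      have hx' := frontier_ball_subset_sphere hx
      rw [mem_sphere_iff_norm] at hx'
      rw [mem_closedBall_iff_norm, add_sub_cancel_left, norm_smul, hx', Real.norm_of_nonneg hτ.1]
      exact mul_le_of_le_one_left hε.le hτ.2

theorem hasMatDeg_comp_vdm [NeZero c] (ht : Function.Injective t)
    (hF : ContinuousOn F {A | LinearIndependent ℍ[ℝ] A})
    (hFLI : ∀ A, LinearIndependent ℍ[ℝ] A → LinearIndependent ℍ[ℝ] (F A)) {R : ℝ}
    (hR : ∀ S : Finset (Fin c ⊕ Fin k), ‖nodeCoeff t S‖ < R) {d : ℤ}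
    (hd : HasMatDeg (fun x => F (stdMat (Fin k) x)) (ball 0 R) d) :
    HasMatDeg (fun x => F (vdm t 0 x)) (ball 0 R) ((c + k).choose c * d) := by
  classical
  set P : Finset (Finset (Fin c ⊕ Fin k)) := Finset.powersetCard c Finset.univ with hP
  have hPc : ∀ S ∈ P, S.card = c := fun S hS => (Finset.mem_powersetCard.1 hS).2
  have hinj : ∀ S ∈ P, ∀ S' ∈ P, S ≠ S' → nodeCoeff t S ≠ nodeCoeff t S' := by
    intro S hS S' hS' hne h
    refine hne (Finset.ext fun j => ?_)
    have h1 := evalAt_nodeCoeff (t := t) (hPc S hS) j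
    rw [h, evalAt_nodeCoeff (hPc S' hS'), Quaternion.coe_inj] at h1
    rw [← eval_nodePoly_eq_zero_iff ht, ← h1, eval_nodePoly_eq_zero_iff ht]
  obtain ⟨ε, ⟨hε1, hε2⟩, hε0⟩ : ∃ ε : ℝ, ((∀ S ∈ P, closedBall (nodeCoeff t S) ε ⊆ ball 0 R ∧
      ∀ j ∉ S, ∀ x ∈ closedBall (nodeCoeff t S) ε,
        evalAt t x j + ((t j ^ c : ℝ) : ℍ[ℝ]) ≠ 0) ∧
      ∀ S ∈ P, ∀ S' ∈ P, S ≠ S' → ε ≤ dist (nodeCoeff t S) (nodeCoeff t S') / 2) ∧ 0 < ε := by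
    have h1 : ∀ᶠ ε in 𝓝 (0 : ℝ), ∀ S ∈ P, closedBall (nodeCoeff t S) ε ⊆ ball 0 R ∧
      ∀ j ∉ S, ∀ x ∈ closedBall (nodeCoeff t S) ε,
        evalAt t x j + ((t j ^ c : ℝ) : ℍ[ℝ]) ≠ 0 := by
      refine (Filter.eventually_all_finset P).2 fun S hS => Filter.Eventually.and ?_ ?_
      · exact eventually_closedBall_subset
          (isOpen_ball.mem_nhds (mem_ball_zero_iff.2 (hR S)))
      · refine Filter.eventually_all.2 fun j => ?_
        by_cases hj : j ∈ S
        · exact Filter.Eventually.of_forall fun ε h => absurd hj h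
        · have ho : IsOpen {x | evalAt t x j + ((t j ^ c : ℝ) : ℍ[ℝ]) ≠ 0} :=
            isOpen_ne_fun ((continuous_evalAt continuous_id j).add continuous_const)
              continuous_const
          have hm : nodeCoeff t S ∈ {x | evalAt t x j + ((t j ^ c : ℝ) : ℍ[ℝ]) ≠ 0} := by
            change _ ≠ _
            rw [evalAt_nodeCoeff (hPc S hS), Ne, ← Quaternion.coe_zero, Quaternion.coe_inj,
              eval_nodePoly_eq_zero_iff ht]
            exact hj
          filter_upwards [eventually_closedBall_subset (ho.mem_nhds hm)] with ε hε _ x hx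
            using hε hx
    have h2 : ∀ᶠ ε in 𝓝 (0 : ℝ), ∀ S ∈ P, ∀ S' ∈ P, S ≠ S' →
        ε ≤ dist (nodeCoeff t S) (nodeCoeff t S') / 2 := by
      refine (Filter.eventually_all_finset P).2 fun S hS =>
        (Filter.eventually_all_finset P).2 fun S' hS' => ?_
      by_cases hne : S = S'
      · exact Filter.Eventually.of_forall fun ε h => absurd hne h
      · filter_upwards [eventually_le_nhds (half_pos (dist_pos.2 (hinj S hS S' hS' hne)))]
          with ε hε _ using hε
    exact (((h1.and h2).filter_mono nhdsWithin_le_nhds).and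
      (self_mem_nhdsWithin : Ioi (0 : ℝ) ∈ 𝓝[>] 0)).exists
  have hcont : Continuous (vdm t 1) := continuous_vdm.comp (Continuous.prodMk_right 1)
  have hLI : ∀ x ∈ closure (ball 0 R) \ ⋃ S ∈ P, ball (nodeCoeff t S) ε,
      LinearIndependent ℍ[ℝ] (vdm t 1 x) := by
    refine fun x hx => linearIndependent_vdm ht fun S hS h => hx.2 (mem_iUnion₂.2 ⟨S, ?_, ?_⟩)
    · exact Finset.mem_powersetCard.2 ⟨Finset.subset_univ _, hS⟩
    · rw [h, one_smul]
      exact mem_ball_self hε0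
  have h1 : HasMatDeg (fun x => F (vdm t 1 x)) (ball 0 R) ((c + k).choose c * d) := by
    have := hasMatDeg_sum isOpen_ball isBounded_ball P (V := fun S => ball (nodeCoeff t S) ε)
      (U := ball 0 R) (φ := fun x => F (vdm t 1 x)) (d := fun _ => d)
      (fun _ _ => isOpen_ball) (fun S hS => ball_subset_closedBall.trans (hε1 S hS).1)
      (fun S hS S' hS' hne => ball_disjoint_ball (by linarith [hε2 S hS S' hS' hne]))
      (hF.comp hcont.continuousOn hLI) (fun x hx => hFLI _ (hLI x hx))
      (fun S hS => hasMatDeg_comp_vdm_ball ht hF hFLI (hPc S hS) hε0 (hε1 S hS).1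
        (hε1 S hS).2 hd)
    simpa [hP] using this
  refine HasMatDeg.homotopy_comp isOpen_ball isBounded_ball (isPreconnected_Icc (a := (0 : ℝ))
    (b := 1)) hF hFLI (h := vdm t) continuous_vdm (fun s hs x hx => linearIndependent_vdm ht
      fun S hS h => ?_) (by simp) (by simp) h1
  rw [isOpen_ball.frontier_eq] at hx
  refine hx.2 ?_
  rw [h, mem_ball_zero_iff, norm_smul, Real.norm_of_nonneg hs.1]
  exact (mul_le_of_le_one_left (norm_nonneg _) hs.2).trans_lt (hR S)

end Count

section Equivariant

theorem contDiff_star_quaternion {N : WithTop ℕ∞} : ContDiff ℝ N (star : ℍ[ℝ] → ℍ[ℝ]) :=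
  IsBoundedLinearMap.contDiff
    { map_add := star_add
      map_smul := fun r a => Quaternion.star_smul r a
      bound := ⟨1, one_pos, fun a => by rw [norm_star, one_mul]⟩ }

theorem continuousOn_image_of_comp {X Y Z : Type*} [TopologicalSpace X] [TopologicalSpace Y]
    [T2Space Y] [TopologicalSpace Z] {S : Set X} (hS : IsCompact S) {π : X → Y}
    (hπ : ContinuousOn π S) {k : Y → Z} (hk : ContinuousOn (fun x => k (π x)) S) :
    ContinuousOn k (π '' S) := by
  have : CompactSpace S := isCompact_iff_compactSpace.1 hS
  have hπc : Continuous (S.imageFactorization π) :=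
    (continuousOn_iff_continuous_domRestrict.1 hπ).subtype_mk _
  have hq := hπc.isClosedMap.isQuotientMap hπc imageFactorization_surjective
  rw [continuousOn_iff_continuous_domRestrict] at hk ⊢
  exact hq.continuous_iff.2 hk

variable {I J κ : Type*} [Fintype I] [Fintype J] [Fintype κ]

theorem dimH_setOf_exists_normalized_lt (hc : Fintype.card κ + Fintype.card I ≤ Fintype.card J + 1)
    {G : ℝ × (κ → ℍ[ℝ]) → I → J → ℍ[ℝ]} (hG : ContDiff ℝ 1 G) (i : I) (j : κ) :
    dimH {B : I × κ → J → ℍ[ℝ] | ∃ (t s : ℝ) (x : κ → ℍ[ℝ]) (v : I → ℍ[ℝ]),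
      x j = (Real.exp s : ℝ) ∧ v i = (Real.exp (-s) : ℝ) ∧
        ∑ a, v a • (G (t, x) a + ∑ b, x b • B (a, b)) = 0} <
      Module.finrank ℝ (I × κ → J → ℍ[ℝ]) := by
  classical
  let P := (ℝ × ℝ) × ({b // b ≠ j} → ℍ[ℝ]) × ({a // a ≠ i} → ℍ[ℝ])
  let x : P → κ → ℍ[ℝ] := fun p b =>
    if h : b ≠ j then p.2.1 ⟨b, h⟩ else Real.exp p.1.2 • (1 : ℍ[ℝ])
  let v : P → I → ℍ[ℝ] := fun p a =>
    if h : a ≠ i then p.2.2 ⟨a, h⟩ else Real.exp (-p.1.2) • (1 : ℍ[ℝ])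
  have hx : ContDiff ℝ 1 x := by
    refine contDiff_pi.2 fun b => ?_
    by_cases h : b ≠ j
    · simp only [x, dif_pos h]
      fun_prop
    · simp only [x, dif_neg h]
      fun_prop
  have hv : ContDiff ℝ 1 v := by
    refine contDiff_pi.2 fun a => ?_
    by_cases h : a ≠ i
    · simp only [v, dif_pos h]
      fun_prop
    · simp only [v, dif_neg h]
      fun_prop
  have hdim : Module.finrank ℝ P < 4 * Fintype.card J := by
    have h1 : Fintype.card {b // b ≠ j} = Fintype.card κ - 1 := Set.card_ne_eq j
    have h2 : Fintype.card {a // a ≠ i} = Fintype.card I - 1 := Set.card_ne_eq i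
    have h3 : 0 < Fintype.card κ := Fintype.card_pos_iff.2 ⟨j⟩
    have h4 : 0 < Fintype.card I := Fintype.card_pos_iff.2 ⟨i⟩
    simp only [P, Module.finrank_prod, finrank_pi_quaternion, Module.finrank_self, h1, h2]
    omega
  have hg : ContDiff ℝ 1 fun p => G (p.1.1, x p) := hG.comp (contDiff_fst.fst.prodMk hx)
  refine (dimH_mono ?_).trans_lt (dimH_setOf_exists_sum_smul_eq_zero_lt hdim
    (a := fun p => ∑ a, v p a • G (p.1.1, x p) a) (w := fun p ab => v p ab.1 * x p ab.2) ?_ ?_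
    (i, j) fun p => ?_)
  · rintro B ⟨t, s, y, u, hy, hu, h⟩
    refine ⟨((t, s), fun b => y b, fun a => u a), ?_⟩
    have hxy : x ((t, s), fun b => y b, fun a => u a) = y := by
      funext b
      by_cases hb : b = j
      · subst hb
        simp [x, hy, ← Quaternion.coe_mul_eq_smul]
      · simp [x, hb]
    have hvu : v ((t, s), fun b => y b, fun a => u a) = u := by
      funext a
      by_cases ha : a = i
      · subst ha
        simp [v, hu, ← Quaternion.coe_mul_eq_smul]
      · simp [v, ha]
    rw [← h]
    simp only [hxy, hvu, Fintype.sum_prod_type, smul_add, Finset.sum_add_distrib, Finset.smul_sum,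
      mul_smul]
  · have (a : I) : ContDiff ℝ 1 fun p => v p a := contDiff_pi.1 hv a
    have (a : I) : ContDiff ℝ 1 fun p => G (p.1.1, x p) a := contDiff_pi.1 hg a
    fun_prop
  · refine contDiff_pi.2 fun ab => ?_
    have := contDiff_pi.1 hv ab.1
    have := contDiff_pi.1 hx ab.2
    exact ContDiff.mul ‹_› ‹_›
  · simp [v, x, smul_smul, ← Real.exp_add]

theorem dense_setOf_forall_linearIndependent_equivariant
    (hc : Fintype.card κ + Fintype.card I ≤ Fintype.card J + 1)
    {G : ℝ × (κ → ℍ[ℝ]) → I → J → ℍ[ℝ]} (hG : ContDiff ℝ 1 G)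
    (hq : ∀ q : ℍ[ℝ], ‖q‖ = 1 → ∀ t x, G (t, q • x) = q • G (t, x)) :
    Dense {B : I × κ → J → ℍ[ℝ] | ∀ t x, x ≠ 0 →
      LinearIndependent ℍ[ℝ] fun a => G (t, x) a + ∑ b, x b • B (a, b)} := by
  rcases isEmpty_or_nonempty (I × κ) with hI | hI
  · refine dense_univ.mono fun B _ t x hx => ?_
    obtain ⟨b, -⟩ := Function.ne_iff.1 hx
    have : IsEmpty I := ⟨fun a => hI.false (a, b)⟩
    exact linearIndependent_empty_type
  let S : I × κ → Set (I × κ → J → ℍ[ℝ]) := fun ij =>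
    {B | ∃ (t s : ℝ) (x : κ → ℍ[ℝ]) (v : I → ℍ[ℝ]),
      x ij.2 = (Real.exp s : ℝ) ∧ v ij.1 = (Real.exp (-s) : ℝ) ∧
        ∑ a, v a • (G (t, x) a + ∑ b, x b • B (a, b)) = 0}
  have hU : dimH (⋃ ij, S ij) < Module.finrank ℝ (I × κ → J → ℍ[ℝ]) := by
    rw [dimH_iUnion]
    obtain ⟨ij, hij⟩ := exists_eq_ciSup_of_finite (f := fun ij => dimH (S ij))
    rw [← hij]
    exact dimH_setOf_exists_normalized_lt hc hG ij.1 ij.2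
  refine (dense_compl_of_dimH_lt_finrank hU).mono fun B hB t x hx => ?_
  rw [Fintype.linearIndependent_iff]
  intro v hv
  by_contra! hcon
  obtain ⟨i, hi⟩ := hcon
  obtain ⟨j, hj⟩ := Function.ne_iff.1 hx
  rw [Pi.zero_apply] at hj
  have hn : 0 < ‖x j‖ := norm_pos_iff.2 hj
  set q : ℍ[ℝ] := ‖x j‖ • (x j)⁻¹ with hqdef
  have hq1 : ‖q‖ = 1 := by
    rw [hqdef, norm_smul, norm_norm, norm_inv, mul_inv_cancel₀ hn.ne']
  have hq0 : q ≠ 0 := norm_ne_zero_iff.1 (by rw [hq1]; exact one_ne_zero)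
  refine hB (mem_iUnion.2 ⟨(i, j), t, Real.log ‖x j‖, q • x,
    fun a => ‖x j‖⁻¹ • (q * (v i)⁻¹) * v a * q⁻¹, ?_, ?_, ?_⟩)
  · rw [Real.exp_log hn, Pi.smul_apply, smul_eq_mul, hqdef, smul_mul_assoc, inv_mul_cancel₀ hj,
      ← Quaternion.coe_mul_eq_smul, mul_one]
  · rw [Real.exp_neg, Real.exp_log hn]
    simp only [smul_mul_assoc]
    rw [mul_assoc q, inv_mul_cancel₀ hi, mul_one, mul_inv_cancel₀ hq0,
      ← Quaternion.coe_mul_eq_smul, mul_one]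
  · have h1 : ∀ a, G (t, q • x) a + ∑ b, (q • x) b • B (a, b) =
        q • (G (t, x) a + ∑ b, x b • B (a, b)) := fun a => by
      rw [hq q hq1, Pi.smul_apply, smul_add, Finset.smul_sum]
      simp only [Pi.smul_apply, smul_eq_mul, mul_smul]
    simp only [h1, smul_smul, inv_mul_cancel_right₀ hq0]
    simp only [mul_smul]
    rw [← Finset.smul_sum, hv, smul_zero]

/-- Equivariant continuous maps on a sphere can be approximated by equivariant `C¹` maps. -/
theorem exists_contDiff_equivariant_norm_sub_lt {R ε : ℝ} (hR : 0 < R) (hε : 0 < ε)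
    {φ : (κ → ℍ[ℝ]) → I → J → ℍ[ℝ]} (hφ : ContinuousOn φ (sphere 0 R))
    (hq : ∀ q : ℍ[ℝ], ‖q‖ = 1 → ∀ x ∈ sphere (0 : κ → ℍ[ℝ]) R, φ (q • x) = q • φ x) :
    ∃ Φ : (κ → ℍ[ℝ]) → I → J → ℍ[ℝ], ContDiff ℝ 1 Φ ∧
      (∀ q : ℍ[ℝ], ‖q‖ = 1 → ∀ x, Φ (q • x) = q • Φ x) ∧
      ∀ x ∈ sphere 0 R, ‖Φ x - φ x‖ < ε := by
  set N : (κ → ℍ[ℝ]) → ℝ := fun x => ∑ b, ‖x b‖ ^ 2 with hN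
  set π : (κ → ℍ[ℝ]) → κ → κ → ℍ[ℝ] := fun x a b => star (x a) * x b with hπ
  set h : (κ → ℍ[ℝ]) → κ → I → J → ℍ[ℝ] := fun x b => (N x)⁻¹ • star (x b) • φ x with hh
  set S : Set (κ → ℍ[ℝ]) := sphere 0 R with hS
  have hSc : IsCompact S := isCompact_sphere _ _
  have hunit : ∀ q : ℍ[ℝ], ‖q‖ = 1 → star q * q = 1 := fun q h => by
    rw [Quaternion.star_mul_self, Quaternion.normSq_eq_norm_mul_self, h]
    simp
  have hπq : ∀ q : ℍ[ℝ], ‖q‖ = 1 → ∀ x, π (q • x) = π x := fun q h x => by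
    funext a b
    simp only [hπ, Pi.smul_apply, smul_eq_mul, star_mul]
    rw [mul_assoc, ← mul_assoc (star q), hunit q h, one_mul]
  have hsphere : ∀ x ∈ S, ∃ b, x b ≠ 0 := fun x hx => by
    refine Function.ne_iff.1 fun h0 : x = 0 => ?_
    rw [hS, mem_sphere_zero_iff_norm, h0, norm_zero] at hx
    exact hR.ne hx
  have hN0 : ∀ x ∈ S, N x ≠ 0 := fun x hx => by
    obtain ⟨b, hb⟩ := hsphere x hx
    exact (Finset.sum_pos' (fun a _ => by positivity)
      ⟨b, Finset.mem_univ _, by positivity⟩).ne'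
  have hfib : ∀ x ∈ S, ∀ y ∈ S, π x = π y → h x = h y := by
    intro x hx y hy hxy
    have hnorm : ∀ b, ‖x b‖ = ‖y b‖ := fun b => by
      have h1 := congrArg norm (congrFun (congrFun hxy b) b)
      simp only [hπ, norm_mul, norm_star] at h1
      exact (mul_self_inj (norm_nonneg _) (norm_nonneg _)).1 h1
    obtain ⟨a, ha⟩ := hsphere x hx
    have hna : ‖x a‖ ≠ 0 := norm_ne_zero_iff.2 ha
    have ha' : y a ≠ 0 := norm_ne_zero_iff.1 (hnorm a ▸ hna)
    set q : ℍ[ℝ] := (star (y a))⁻¹ * star (x a) with hqd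
    have hq1 : ‖q‖ = 1 := by
      rw [hqd, norm_mul, norm_inv, norm_star, norm_star, ← hnorm, inv_mul_cancel₀ hna]
    have hyx : y = q • x := by
      funext b
      have h1 : star (x a) * x b = star (y a) * y b := congrFun (congrFun hxy a) b
      rw [Pi.smul_apply, smul_eq_mul, hqd, mul_assoc, h1,
        inv_mul_cancel_left₀ (star_ne_zero.2 ha')]
    have hNx : N y = N x := by simp only [hN, hnorm]
    funext b
    simp only [hh, hNx]
    rw [hyx, hq q hq1 x hx, Pi.smul_apply, smul_eq_mul, star_mul, smul_smul, mul_assoc,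
      hunit q hq1, mul_one]
  have hφh : ∀ x ∈ S, ∑ b, x b • h x b = φ x := fun x hx => by
    have h1 : ∀ b, x b • h x b = ((N x)⁻¹ * ‖x b‖ ^ 2) • φ x := fun b => by
      simp only [hh]
      rw [smul_comm, smul_smul, Quaternion.self_mul_star, Quaternion.normSq_eq_norm_mul_self,
        mul_smul, pow_two]
      congr 1
      funext a c
      exact Quaternion.coe_mul_eq_smul _ _
    simp only [h1]
    rw [← Finset.sum_smul, ← Finset.mul_sum, inv_mul_cancel₀ (hN0 x hx), one_smul]
  have hπc : Continuous π := by
    have := continuous_star (R := ℍ[ℝ])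
    fun_prop
  have hhc : ContinuousOn h S := by
    refine continuousOn_pi.2 fun b => ?_
    have h1 : ContinuousOn (fun x => (N x)⁻¹) S :=
      ContinuousOn.inv₀ (by fun_prop) hN0
    have h2 : ContinuousOn (fun x : κ → ℍ[ℝ] => star (x b)) S := by fun_prop
    exact h1.smul (h2.smul hφ)
  set k : (κ → κ → ℍ[ℝ]) → κ → I → J → ℍ[ℝ] := fun p => h (Function.invFunOn π S p) with hk
  have hkπ : ∀ x ∈ S, k (π x) = h x := fun x hx =>
    hfib _ (Function.invFunOn_mem ⟨x, hx, rfl⟩) _ hx (Function.invFunOn_eq ⟨x, hx, rfl⟩)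
  have hkc : ContinuousOn k (π '' S) :=
    continuousOn_image_of_comp hSc hπc.continuousOn (hhc.congr hkπ)
  set η : ℝ := ε / ((Fintype.card κ + 1) * (R + 1)) with hη
  have hη0 : 0 < η := by positivity
  obtain ⟨K, hK, hKk⟩ := exists_contDiff_norm_sub_lt (hSc.image hπc).isClosed hkc hη0
  have hπd : ContDiff ℝ 1 π := by
    refine contDiff_pi.2 fun a => contDiff_pi.2 fun b => ?_
    have h1 : ContDiff ℝ 1 fun x : κ → ℍ[ℝ] => star (x a) :=
      contDiff_star_quaternion.comp (contDiff_apply ℝ _ a)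
    have h2 : ContDiff ℝ 1 fun x : κ → ℍ[ℝ] => x b := contDiff_apply ℝ _ b
    exact h1.mul h2
  refine ⟨fun x => ∑ b, x b • K (π x) b, ?_, fun q h1 x => ?_, fun x hx => ?_⟩
  · have := hK.comp hπd
    have (b : κ) : ContDiff ℝ 1 fun x => K (π x) b := contDiff_pi.1 this b
    fun_prop
  · simp only [hπq q h1, Pi.smul_apply, smul_eq_mul, mul_smul, Finset.smul_sum]
  · have h1 : ∑ b, x b • K (π x) b - φ x = ∑ b, x b • (K (π x) - k (π x)) b := by
      rw [← hφh x hx, ← Finset.sum_sub_distrib, hkπ x hx]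
      simp only [Pi.sub_apply, smul_sub]
    rw [h1]
    have hxR : ‖x‖ = R := mem_sphere_zero_iff_norm.1 hx
    calc ‖∑ b, x b • (K (π x) - k (π x)) b‖
        ≤ ∑ b, ‖x b • (K (π x) - k (π x)) b‖ := norm_sum_le _ _
      _ ≤ ∑ _b : κ, R * η := by
          refine Finset.sum_le_sum fun b _ => ?_
          rw [norm_smul]
          refine mul_le_mul (hxR ▸ norm_le_pi_norm x b)
            ((norm_le_pi_norm _ b).trans (hKk _ ⟨x, hx, rfl⟩).le) (norm_nonneg _) hR.le
      _ = Fintype.card κ * (R * η) := by simp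
      _ < (Fintype.card κ + 1) * ((R + 1) * η) := by
          have : R * η < (R + 1) * η := by gcongr; linarith
          have h4 : (0 : ℝ) ≤ Fintype.card κ := by positivity
          nlinarith [mul_pos hR hη0]
      _ = ε := by rw [hη]; field_simp

end Equivariant

section Comparison

variable {κ ι : Type} [Fintype κ] [Fintype ι]

theorem HasMatDeg.eq_of_equivariant [Nonempty κ] {R : ℝ} (hR : 0 < R)
    {φ T : (κ → ℍ[ℝ]) → Option ι → κ ⊕ ι → ℍ[ℝ]} (hφ : ContinuousOn φ (sphere 0 R))
    (hφq : ∀ q : ℍ[ℝ], ‖q‖ = 1 → ∀ x ∈ sphere (0 : κ → ℍ[ℝ]) R, φ (q • x) = q • φ x)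
    (hT : ContDiff ℝ 1 T) (hTq : ∀ q : ℍ[ℝ], ‖q‖ = 1 → ∀ x, T (q • x) = q • T x)
    {d d' : ℤ} (hd : HasMatDeg φ (ball 0 R) d) (hd' : HasMatDeg T (ball 0 R) d') : d = d' := by
  obtain ⟨ε, hε, h⟩ := hd.exists_of_norm_sub_lt
  obtain ⟨ε', hε', h'⟩ := hd'.exists_of_norm_sub_lt
  have hfr : frontier (ball (0 : κ → ℍ[ℝ]) R) ⊆ sphere 0 R := frontier_ball_subset_sphere
  obtain ⟨Φ, hΦ, hΦq, hΦφ⟩ := exists_contDiff_equivariant_norm_sub_lt hR (half_pos hε) hφ hφq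
  have hGd : ContDiff ℝ 1 fun p : ℝ × (κ → ℍ[ℝ]) => (1 - p.1) • Φ p.2 + p.1 • T p.2 := by
    have h1 := hΦ.comp (contDiff_snd (E := ℝ))
    have h2 := hT.comp (contDiff_snd (E := ℝ))
    exact ((contDiff_const.sub contDiff_fst).smul h1).add (contDiff_fst.smul h2)
  have hdense := dense_setOf_forall_linearIndependent_equivariant (κ := κ) (I := Option ι)
    (J := κ ⊕ ι) (by simp; omega) hGd fun q hq t x => by
      simp only [hΦq q hq, hTq q hq, smul_add]
      rw [smul_comm q, smul_comm q]
  set E : (Option ι × κ → κ ⊕ ι → ℍ[ℝ]) → (κ → ℍ[ℝ]) → Option ι → κ ⊕ ι → ℍ[ℝ] :=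
    fun B x a => ∑ b, x b • B (a, b) with hE
  obtain ⟨B, hBE, hB⟩ : ∃ B, (∀ x ∈ sphere (0 : κ → ℍ[ℝ]) R, ‖E B x‖ < min (ε / 2) ε') ∧
      ∀ (t : ℝ) (x), x ≠ 0 → LinearIndependent ℍ[ℝ] fun a =>
        ((1 - t) • Φ x + t • T x) a + ∑ b, x b • B (a, b) := by
    set δ : ℝ := min (ε / 2) ε' / (Fintype.card κ * R + 1) with hδ
    have hδ0 : 0 < δ := div_pos (lt_min (half_pos hε) hε') (by positivity)
    obtain ⟨B, hB1, hB2⟩ := hdense.exists_mem_open isOpen_ball ⟨0, mem_ball_self hδ0⟩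
    refine ⟨B, fun x hx => ?_, hB1⟩
    rw [mem_ball_zero_iff] at hB2
    have hxR : ‖x‖ = R := mem_sphere_zero_iff_norm.1 hx
    have h1 : ‖E B x‖ ≤ Fintype.card κ * R * ‖B‖ := by
      refine (pi_norm_le_iff_of_nonneg (by positivity)).2 fun a => ?_
      refine (norm_sum_smul_le x fun b => B (a, b)).trans ?_
      rw [hxR]
      gcongr
      exact (pi_norm_le_iff_of_nonneg (norm_nonneg _)).2 fun b => norm_le_pi_norm B (a, b)
    calc ‖E B x‖ ≤ Fintype.card κ * R * ‖B‖ := h1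
      _ ≤ (Fintype.card κ * R + 1) * ‖B‖ := by gcongr; linarith
      _ < (Fintype.card κ * R + 1) * δ := by gcongr
      _ = min (ε / 2) ε' := by rw [hδ]; field_simp
  have hEc : Continuous (E B) := by
    refine continuous_pi fun a => ?_
    simp only [hE]
    fun_prop
  have h0 : HasMatDeg (fun x => Φ x + E B x) (ball 0 R) d := by
    refine h _ fun x hx => ?_
    have h1 := hΦφ x (hfr hx)
    have h2 := (hBE x (hfr hx)).trans_le (min_le_left _ _)
    have h3 : Φ x + E B x - φ x = (Φ x - φ x) + E B x := by abel
    rw [h3]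
    linarith [norm_add_le (Φ x - φ x) (E B x)]
  have h1 : HasMatDeg (fun x => T x + E B x) (ball 0 R) d' := by
    refine h' _ fun x hx => ?_
    rw [add_sub_cancel_left]
    exact (hBE x (hfr hx)).trans_le (min_le_right _ _)
  have hH : Continuous (Function.uncurry fun (t : ℝ) x =>
      (1 - t) • Φ x + t • T x + E B x) :=
    hGd.continuous.add (hEc.comp continuous_snd)
  have h2 := HasMatDeg.linear_homotopy isOpen_ball isBounded_ball (U := ball 0 R) (d := d)
    (h := fun t x => (1 - t) • Φ x + t • T x + E B x) hH.continuousOn (fun t _ x hx => ?_)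
    (by simpa using h0)
  · refine HasMatDeg.unique ?_ (by simpa using h2) h1
    exact (hT.continuous.add hEc).continuousOn
  · refine hB t x fun h0 => ?_
    have := mem_sphere_zero_iff_norm.1 (hfr hx)
    rw [h0, norm_zero] at this
    exact hR.ne this

end Comparison

section GramSchmidt

variable {J : Type*} [Fintype J]

/-- The component of `u` orthogonal to the orthonormal rows of `e`. -/
noncomputable def orthPart {k : ℕ} (e : Fin k → J → ℍ[ℝ]) (u : J → ℍ[ℝ]) : J → ℍ[ℝ] :=
  u - ∑ j, (u ⬝ᵥ star (e j)) • e j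

/-- The Euclidean normalization of a quaternionic vector. -/
noncomputable def unitVec (u : J → ℍ[ℝ]) : J → ℍ[ℝ] := (√(∑ a, ‖u a‖ ^ 2))⁻¹ • u

theorem dotProduct_star_self (u : J → ℍ[ℝ]) :
    u ⬝ᵥ star u = ((∑ a, ‖u a‖ ^ 2 : ℝ) : ℍ[ℝ]) := by
  refine Eq.trans (Finset.sum_congr rfl fun a _ => ?_) (map_sum (algebraMap ℝ ℍ[ℝ]) _ _).symm
  rw [Pi.star_apply, Quaternion.self_mul_star, Quaternion.normSq_eq_norm_mul_self, pow_two]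
  rfl

theorem sum_norm_sq_pos {u : J → ℍ[ℝ]} (hu : u ≠ 0) : 0 < ∑ a, ‖u a‖ ^ 2 := by
  obtain ⟨a, ha⟩ := Function.ne_iff.1 hu
  rw [Pi.zero_apply] at ha
  exact Finset.sum_pos' (fun b _ => by positivity) ⟨a, Finset.mem_univ _, by positivity⟩

theorem unitVec_dotProduct_star_self {u : J → ℍ[ℝ]} (hu : u ≠ 0) :
    unitVec u ⬝ᵥ star (unitVec u) = 1 := by
  have h := sum_norm_sq_pos hu
  rw [dotProduct_star_self]
  simp only [unitVec, Pi.smul_apply, norm_smul, mul_pow]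
  rw [← Finset.mul_sum, norm_inv, Real.norm_of_nonneg (Real.sqrt_nonneg _), inv_pow,
    Real.sq_sqrt h.le, inv_mul_cancel₀ h.ne', Quaternion.coe_one]

theorem star_dotProduct_star (u v : J → ℍ[ℝ]) : star (u ⬝ᵥ star v) = v ⬝ᵥ star u := by
  simp [dotProduct]

theorem unitVec_smul {q : ℍ[ℝ]} (hq : ‖q‖ = 1) (u : J → ℍ[ℝ]) :
    unitVec (q • u) = q • unitVec u := by
  simp only [unitVec, Pi.smul_apply, norm_smul, hq, one_mul]
  exact smul_comm _ _ _

theorem orthPart_smul {k : ℕ} {q : ℍ[ℝ]} (hq : ‖q‖ = 1) (e : Fin k → J → ℍ[ℝ]) (u : J → ℍ[ℝ]) :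
    orthPart (q • e) (q • u) = q • orthPart e u := by
  have h1 : star q * q = 1 := by
    rw [Quaternion.star_mul_self, Quaternion.normSq_eq_norm_mul_self, hq]
    simp
  have h2 : ∀ j, (q • u) ⬝ᵥ star ((q • e) j) = q * (u ⬝ᵥ star (e j)) * star q := fun j => by
    simp only [dotProduct, Finset.mul_sum, Finset.sum_mul]
    simp [mul_assoc]
  rw [orthPart, orthPart, smul_sub, Finset.smul_sum]
  congr 1
  refine Finset.sum_congr rfl fun j _ => ?_
  rw [h2, Pi.smul_apply, smul_smul, smul_smul, mul_assoc, h1, mul_one]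

theorem orthPart_dotProduct_star {k : ℕ} {e : Fin k → J → ℍ[ℝ]}
    (he : ∀ i j, e i ⬝ᵥ star (e j) = if i = j then 1 else 0) (u : J → ℍ[ℝ]) (j : Fin k) :
    orthPart e u ⬝ᵥ star (e j) = 0 := by
  rw [orthPart, sub_dotProduct, sum_dotProduct]
  simp [smul_dotProduct, he]

/-- Gram–Schmidt orthonormalization over the quaternions. -/
noncomputable def gramSchmidt : (k : ℕ) → (Fin k → J → ℍ[ℝ]) → Fin k → J → ℍ[ℝ]
  | 0, A => A
  | k + 1, A => Fin.snoc (α := fun _ => J → ℍ[ℝ]) (gramSchmidt k (Fin.init A))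
      (unitVec (orthPart (gramSchmidt k (Fin.init A)) (A (Fin.last k))))

theorem gramSchmidt_smul {q : ℍ[ℝ]} (hq : ‖q‖ = 1) (k : ℕ) (A : Fin k → J → ℍ[ℝ]) :
    gramSchmidt k (q • A) = q • gramSchmidt k A := by
  induction k with
  | zero => rfl
  | succ k ih =>
    have h1 : Fin.init (q • A) = q • Fin.init A := rfl
    funext i
    refine Fin.lastCases ?_ (fun i => ?_) i
    · simp only [gramSchmidt, Pi.smul_apply, Fin.snoc_last, h1, ih]
      rw [orthPart_smul hq, unitVec_smul hq]
    · simp only [gramSchmidt, Pi.smul_apply, Fin.snoc_castSucc, h1, ih]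

theorem gramSchmidt_mem_span (k : ℕ) (A : Fin k → J → ℍ[ℝ]) (i : Fin k) :
    gramSchmidt k A i ∈ Submodule.span ℍ[ℝ] (range A) := by
  induction k with
  | zero => exact i.elim0
  | succ k ih =>
    have h1 : ∀ j, gramSchmidt k (Fin.init A) j ∈ Submodule.span ℍ[ℝ] (range A) := fun j =>
      Submodule.span_mono (range_comp_subset_range Fin.castSucc A) (ih (Fin.init A) j)
    refine Fin.lastCases ?_ (fun i => ?_) i
    · simp only [gramSchmidt, Fin.snoc_last, unitVec, orthPart]
      exact Submodule.smul_of_tower_mem _ _ (sub_mem (Submodule.subset_span ⟨_, rfl⟩)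
        (sum_mem fun j _ => Submodule.smul_mem _ _ (h1 j)))
    · simpa only [gramSchmidt, Fin.snoc_castSucc] using h1 i

theorem orthPart_gramSchmidt_ne_zero {k : ℕ} {A : Fin (k + 1) → J → ℍ[ℝ]}
    (hA : LinearIndependent ℍ[ℝ] A) :
    orthPart (gramSchmidt k (Fin.init A)) (A (Fin.last k)) ≠ 0 := by
  intro h
  refine (linearIndependent_finSucc'.1 hA).2 ?_
  rw [sub_eq_zero.1 h]
  exact sum_mem fun j _ => Submodule.smul_mem _ _ (gramSchmidt_mem_span k _ j)

theorem gramSchmidt_orthonormal {k : ℕ} {A : Fin k → J → ℍ[ℝ]} (hA : LinearIndependent ℍ[ℝ] A)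
    (i j : Fin k) :
    gramSchmidt k A i ⬝ᵥ star (gramSchmidt k A j) = if i = j then 1 else 0 := by
  induction k with
  | zero => exact i.elim0
  | succ k ih =>
    have he := ih (linearIndependent_finSucc'.1 hA).1
    have h0 : ∀ j, unitVec (orthPart (gramSchmidt k (Fin.init A)) (A (Fin.last k))) ⬝ᵥ
        star (gramSchmidt k (Fin.init A) j) = 0 := fun j => by
      rw [unitVec, smul_dotProduct, orthPart_dotProduct_star he, smul_zero]
    refine Fin.lastCases ?_ (fun i => ?_) i <;> refine Fin.lastCases ?_ (fun j => ?_) j <;>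
      simp only [gramSchmidt, Fin.snoc_last, Fin.snoc_castSucc]
    · rw [if_pos trivial, unitVec_dotProduct_star_self (orthPart_gramSchmidt_ne_zero hA)]
    · rw [h0, if_neg (Fin.castSucc_lt_last j).ne']
    · rw [← star_dotProduct_star, h0, star_zero, if_neg (Fin.castSucc_lt_last i).ne]
    · rw [he]
      simp

theorem continuousOn_gramSchmidt (k : ℕ) :
    ContinuousOn (gramSchmidt (J := J) k) {A | LinearIndependent ℍ[ℝ] A} := by
  induction k with
  | zero => exact continuousOn_id
  | succ k ih =>
    have hinit : ContinuousOn (fun A : Fin (k + 1) → J → ℍ[ℝ] => gramSchmidt k (Fin.init A))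
        {A | LinearIndependent ℍ[ℝ] A} :=
      ih.comp (by unfold Fin.init; fun_prop) fun A hA => (linearIndependent_finSucc'.1 hA).1
    have horth : ContinuousOn (fun A : Fin (k + 1) → J → ℍ[ℝ] =>
        orthPart (gramSchmidt k (Fin.init A)) (A (Fin.last k)))
        {A | LinearIndependent ℍ[ℝ] A} := by
      have h1 (j : Fin k) := continuousOn_pi.1 hinit j
      have h2 (j : Fin k) (a : J) := continuousOn_pi.1 (h1 j) a
      unfold orthPart dotProduct
      simp only [Pi.star_apply]
      fun_prop
    refine continuousOn_pi.2 fun i => ?_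
    refine Fin.lastCases ?_ (fun i => ?_) i
    · simp only [gramSchmidt, Fin.snoc_last, unitVec]
      have h1 (a : J) := continuousOn_pi.1 horth a
      have h2 : ContinuousOn (fun A : Fin (k + 1) → J → ℍ[ℝ] =>
          √(∑ a, ‖orthPart (gramSchmidt k (Fin.init A)) (A (Fin.last k)) a‖ ^ 2))
          {A | LinearIndependent ℍ[ℝ] A} := by fun_prop
      exact (h2.inv₀ fun A hA =>
        (Real.sqrt_pos.2 (sum_norm_sq_pos (orthPart_gramSchmidt_ne_zero hA))).ne').smul horth
    · simp only [gramSchmidt, Fin.snoc_castSucc]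
      exact continuousOn_pi.1 hinit i

end GramSchmidt

section Divisibility

variable {c k l : ℕ}

theorem evalAt_smul_left {t : Fin c ⊕ Fin k → ℝ} (q : ℍ[ℝ]) (x : Fin c → ℍ[ℝ])
    (j : Fin c ⊕ Fin k) : evalAt t (q • x) j = q * evalAt t x j := by
  simp only [evalAt, Finset.mul_sum, Pi.smul_apply, smul_eq_mul, mul_smul_comm]

theorem vdm_zero_smul {t : Fin c ⊕ Fin k → ℝ} (q : ℍ[ℝ]) (x : Fin c → ℍ[ℝ]) :
    vdm t 0 (q • x) = q • vdm t 0 x := by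
  funext o j
  simp [vdm, evalAt_smul_left]

theorem contDiff_vdm_zero {t : Fin c ⊕ Fin k → ℝ} : ContDiff ℝ 1 (vdm t 0) := by
  unfold vdm evalAt
  fun_prop

theorem choose_dvd_choose_of_equivariant [NeZero c]
    {F : (Option (Fin k) → Fin c ⊕ Fin k → ℍ[ℝ]) → Option (Fin l) → Fin c ⊕ Fin l → ℍ[ℝ]}
    (hF : ContinuousOn F {A | LinearIndependent ℍ[ℝ] A})
    (hFLI : ∀ A, LinearIndependent ℍ[ℝ] A → LinearIndependent ℍ[ℝ] (F A))
    (hFq : ∀ q : ℍ[ℝ], ‖q‖ = 1 → ∀ A, LinearIndependent ℍ[ℝ] A → F (q • A) = q • F A) :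
    (c + k).choose c ∣ (c + l).choose c := by
  have hnode : ∀ r : ℕ, ∃ t : Fin c ⊕ Fin r → ℝ, Function.Injective t := fun r =>
    ⟨fun j => ((Fintype.equivFin (Fin c ⊕ Fin r) j : ℕ) : ℝ),
      Nat.cast_injective.comp (Fin.val_injective.comp (Equiv.injective _))⟩
  obtain ⟨t, ht⟩ := hnode k
  obtain ⟨t', ht'⟩ := hnode l
  obtain ⟨R, hRt, hRt', hR⟩ : ∃ R : ℝ, (∀ S, ‖nodeCoeff t S‖ < R) ∧ (∀ S, ‖nodeCoeff t' S‖ < R) ∧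
      0 < R := by
    have h1 : ∀ᶠ R : ℝ in atTop, ∀ S, ‖nodeCoeff t S‖ < R :=
      Filter.eventually_all.2 fun S => eventually_gt_atTop _
    have h2 : ∀ᶠ R : ℝ in atTop, ∀ S, ‖nodeCoeff t' S‖ < R :=
      Filter.eventually_all.2 fun S => eventually_gt_atTop _
    exact (h1.and (h2.and (eventually_gt_atTop 0))).exists
  have hne : ∀ x ∈ sphere (0 : Fin c → ℍ[ℝ]) R, x ≠ 0 := fun x hx h => by
    rw [mem_sphere_zero_iff_norm, h, norm_zero] at hx
    exact hR.ne hx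
  have hstdLI : ∀ x ∈ sphere (0 : Fin c → ℍ[ℝ]) R,
      LinearIndependent ℍ[ℝ] (stdMat (Fin k) x) := fun x hx => linearIndependent_stdMat (hne x hx)
  have hLI : ∀ x ∈ sphere (0 : Fin c → ℍ[ℝ]) R, LinearIndependent ℍ[ℝ] (vdm t 0 x) :=
    fun x hx => linearIndependent_vdm ht fun S _ => by
      rw [zero_smul]
      exact hne x hx
  have hfr : frontier (ball (0 : Fin c → ℍ[ℝ]) R) ⊆ sphere 0 R := frontier_ball_subset_sphere
  obtain ⟨d, hd⟩ := exists_hasMatDeg isOpen_ball isBounded_ball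
    (φ := fun x => F (stdMat (Fin k) x)) (U := ball 0 R)
    (hF.comp contDiff_stdMat.continuous.continuousOn fun x hx => hstdLI x (hfr hx))
    fun x hx => hFLI _ (hstdLI x (hfr hx))
  have h1 := hasMatDeg_comp_vdm ht hF hFLI hRt hd
  have h2 := hasMatDeg_comp_vdm (F := id) ht' continuousOn_id (fun _ => id) hRt'
    (hasMatDeg_stdMat hR)
  have h3 := HasMatDeg.eq_of_equivariant hR
    (hF.comp contDiff_vdm_zero.continuous.continuousOn hLI)
    (fun q hq x hx => by
      change F (vdm t 0 (q • x)) = q • F (vdm t 0 x)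
      rw [vdm_zero_smul, hFq q hq _ (hLI x hx)]) contDiff_vdm_zero
    (fun q _ x => vdm_zero_smul q x) h1 h2
  exact Int.natCast_dvd_natCast.1 ⟨d, by rw [h3, mul_one]⟩

end Divisibility

end BrouwerDegree

/-- If `n - k = m - l` and there exists an `S³`-equivariant continuous map
`ℍV_{n,k} → ℍV_{m,l}` (equivariant for entrywise left multiplication by unit quaternions),
then `C(n, n-k+1)` divides `C(m, m-l+1)`. -/
theorem stmt1 (n k m l : ℕ) (hk : 1 ≤ k) (hkn : k ≤ n) (hl : 1 ≤ l) (hlm : l ≤ m)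
    (hcodim : n - k = m - l)
    (f : QStiefel n k → QStiefel m l) (hf : Continuous f)
    (heq : ∀ (q : ℍ[ℝ]), ‖q‖ = 1 → ∀ (A : QStiefel n k)
      (h : (q • A.1) * (q • A.1)ᴴ = 1),
      (f ⟨q • A.1, h⟩).1 = q • (f A).1) :
    Nat.choose n (n - k + 1) ∣ Nat.choose m (m - l + 1) := by
  classical
  obtain ⟨c, k', rfl, rfl, hc⟩ : ∃ c k', n = c + k' ∧ k = k' + 1 ∧ c = n - k + 1 :=
    ⟨n - k + 1, k - 1, by omega, by omega, rfl⟩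
  obtain ⟨l', rfl, rfl⟩ : ∃ l', m = c + l' ∧ l = l' + 1 := ⟨l - 1, by omega, by omega⟩
  have : NeZero c := ⟨by omega⟩
  rw [← hcodim, ← hc]
  let toRect (A : Option (Fin k') → Fin c ⊕ Fin k' → ℍ[ℝ]) : Fin (k' + 1) → Fin (c + k') → ℍ[ℝ] :=
    fun i j => A (finSuccEquiv k' i) (finSumFinEquiv.symm j)
  have hLI : ∀ A, LinearIndependent ℍ[ℝ] A → LinearIndependent ℍ[ℝ] (toRect A) := fun A hA =>
    (hA.comp _ (finSuccEquiv k').injective).map' (LinearEquiv.funCongrLeft ℍ[ℝ] ℍ[ℝ]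
      finSumFinEquiv.symm).toLinearMap (LinearEquiv.ker _)
  have hmem : ∀ A, LinearIndependent ℍ[ℝ] A →
      Matrix.of (BrouwerDegree.gramSchmidt _ (toRect A)) *
        (Matrix.of (BrouwerDegree.gramSchmidt _ (toRect A)))ᴴ = 1 := fun A hA => by
    ext1 i j
    rw [Matrix.one_apply, ← BrouwerDegree.gramSchmidt_orthonormal (hLI A hA) i j]
    rfl
  let g (A : {A : Option (Fin k') → Fin c ⊕ Fin k' → ℍ[ℝ] // LinearIndependent ℍ[ℝ] A}) :
      QStiefel (c + k') (k' + 1) :=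
    ⟨Matrix.of (BrouwerDegree.gramSchmidt _ (toRect A.1)), hmem A.1 A.2⟩
  have hg : Continuous g := by
    refine Continuous.subtype_mk ?_ _
    refine (BrouwerDegree.continuousOn_gramSchmidt (k' + 1)).comp_continuous ?_ fun A => hLI _ A.2
    fun_prop
  let F (A : Option (Fin k') → Fin c ⊕ Fin k' → ℍ[ℝ]) : Option (Fin l') → Fin c ⊕ Fin l' → ℍ[ℝ] :=
    if hA : LinearIndependent ℍ[ℝ] A then
      fun o j => (f (g ⟨A, hA⟩)).1 ((finSuccEquiv l').symm o) (finSumFinEquiv j)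
    else 0
  refine BrouwerDegree.choose_dvd_choose_of_equivariant (F := F) ?_ (fun A hA => ?_)
    fun q hq A hA => ?_
  · rw [continuousOn_iff_continuous_domRestrict]
    have h1 : Continuous fun A => (f (g A)).1 := continuous_subtype_val.comp (hf.comp hg)
    refine Continuous.congr (f := fun A o j =>
      (f (g A)).1 ((finSuccEquiv l').symm o) (finSumFinEquiv j)) ?_ fun A => ?_
    · exact continuous_pi fun o => continuous_pi fun j => h1.matrix_elem _ _
    · have h2 : F A.1 = fun o j =>
        (f (g A)).1 ((finSuccEquiv l').symm o) (finSumFinEquiv j) := dif_pos A.2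
      exact h2.symm
  · have h1 : F A = fun o j =>
      (f (g ⟨A, hA⟩)).1 ((finSuccEquiv l').symm o) (finSumFinEquiv j) := dif_pos hA
    have h2 : LinearIndependent ℍ[ℝ] (f (g ⟨A, hA⟩)).1 :=
      BrouwerDegree.linearIndependent_of_vecMul fun v hv => by
        rw [← Matrix.vecMul_one v, ← (f (g ⟨A, hA⟩)).2, ← Matrix.vecMul_vecMul, hv,
          Matrix.zero_vecMul]
    rw [h1]
    exact (h2.comp _ (finSuccEquiv l').symm.injective).map' (LinearEquiv.funCongrLeft ℍ[ℝ] ℍ[ℝ]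
      finSumFinEquiv).toLinearMap (LinearEquiv.ker _)
  · have hq0 : q ≠ 0 := norm_ne_zero_iff.1 (by rw [hq]; exact one_ne_zero)
    have hqA : LinearIndependent ℍ[ℝ] (q • A) := by
      refine Fintype.linearIndependent_iff.2 fun v hv i => ?_
      refine (mul_eq_zero.1
        (Fintype.linearIndependent_iff.1 hA (fun i => v i * q) ?_ i)).resolve_right hq0
      simpa only [mul_smul, Pi.smul_apply] using hv
    have h1 : q • (g ⟨A, hA⟩).1 = (g ⟨q • A, hqA⟩).1 :=
      (BrouwerDegree.gramSchmidt_smul hq _ (toRect A)).symm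
    have h2 : (q • (g ⟨A, hA⟩).1) * (q • (g ⟨A, hA⟩).1)ᴴ = 1 := h1 ▸ (g ⟨q • A, hqA⟩).2
    have h3 := heq q hq (g ⟨A, hA⟩) h2
    have h4 : (⟨q • (g ⟨A, hA⟩).1, h2⟩ : QStiefel (c + k') (k' + 1)) = g ⟨q • A, hqA⟩ :=
      Subtype.ext h1
    rw [h4] at h3
    funext o j
    simp only [F, dif_pos hA, dif_pos hqA, h3]
    rfl
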